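/- (Comparison principle) Under assumptions (H1), (H2) and (H3), if (ũ¹, M̃¹) is a supersolution and (ũ², M̃²) is a subsolution of the backward stochastic Hamilton–Jacobi equation d ũ_t = H̃_t(Dũ_t, x) dt + dM̃_t with terminal condition G̃, then ℙ-a.s. ũ¹ ≥ ũ² in ℝ^d×[0,T]. -/

import Mathlib

open MeasureTheory ProbabilityTheory Filter Set
open scoped ENNReal NNReal Topology RealInnerProductSpace

noncomputable section

variable (d : ℕ) {Ω : Type*} [mΩ : MeasurableSpace Ω]

local notation "V" => EuclideanSpace ℝ (Fin d)

/-- `f` is semiconcave with constant `C`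
(equivalent to `D²f z·z ≤ C` for `|z| ≤ 1` in the sense of distributions). -/
def SemiconcaveWith (C : ℝ) (f : V → ℝ) : Prop :=
  ∀ x y : V, ∀ θ : ℝ, 0 ≤ θ → θ ≤ 1 →
    θ * f x + (1 - θ) * f y - f (θ • x + (1 - θ) • y) ≤ C / 2 * (θ * (1 - θ)) * ‖x - y‖ ^ 2

/-- `W` is a `d`-dimensional Wiener process adapted to the filtration `F`, with increments
independent of the past and Gaussian increments. -/
def IsWienerProcess (μ : Measure Ω) (F : Filtration ℝ mΩ) (W : ℝ → Ω → V) : Prop :=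
  (∀ᵐ ω ∂μ, W 0 ω = 0) ∧
  (∀ᵐ ω ∂μ, Continuous fun t => W t ω) ∧
  Adapted F W ∧
  (∀ s t : ℝ, 0 ≤ s → s ≤ t →
    Indep (F s) (MeasurableSpace.comap (fun ω => W t ω - W s ω) inferInstance) μ) ∧
  (∀ s t : ℝ, 0 ≤ s → s ≤ t → ∀ v : V,
    Measure.map (fun ω => ⟪v, W t ω - W s ω⟫) μ =
      gaussianReal 0 (Real.toNNReal ((t - s) * ‖v‖ ^ 2)))

/-- Assumption (H1): `G̃ ∈ L^∞(Ω, F_T, C²(ℝ^d))` and `H̃` is an adapted process of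
locally `C²` functions. -/
def H1Hyp (μ : Measure Ω) (F : Filtration ℝ mΩ) (T : ℝ)
    (H : ℝ → V → V → Ω → ℝ) (G : V → Ω → ℝ) : Prop :=
  (∃ C : ℝ, 0 < C ∧ ∀ ω : Ω, ContDiff ℝ 2 (fun x : V => G x ω) ∧ ∀ x : V,
      |G x ω| + ‖fderiv ℝ (fun y : V => G y ω) x‖ +
        ‖iteratedFDeriv ℝ 2 (fun y : V => G y ω) x‖ ≤ C) ∧
  (∀ x : V, StronglyMeasurable[F T] fun ω => G x ω) ∧
  (∀ ω : Ω, ∀ t : ℝ, ContDiff ℝ 2 fun q : V × V => H t q.1 q.2 ω) ∧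
  (∀ p x : V, Adapted F fun t ω => H t p x ω) ∧
  (∀ p x : V, ∀ ω : Ω, Continuous fun t => H t p x ω)

/-- Assumption (H2): the Hamiltonian satisfies condition (HH) uniformly in `t ∈ [0,T]`, `ω`. -/
def H2Hyp (T : ℝ) (H : ℝ → V → V → Ω → ℝ) : Prop :=
  (∀ t ∈ Icc (0:ℝ) T, ∀ ω : Ω, ∀ x : V, ConvexOn ℝ univ fun p : V => H t p x ω) ∧
  (∀ R : ℝ, 0 < R → ∃ C : ℝ, 0 < C ∧ ∀ t ∈ Icc (0:ℝ) T, ∀ ω : Ω, ∀ p x : V, ‖p‖ ≤ R →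
      |H t p x ω| + ‖fderiv ℝ (fun q : V => H t q x ω) p‖ +
        ‖fderiv ℝ (fun y : V => fderiv ℝ (fun q : V => H t q y ω) p) x‖ +
        ‖iteratedFDeriv ℝ 2 (fun q : V => H t q x ω) p‖ ≤ C) ∧
  (∃ lam C₀ : ℝ, 0 < lam ∧ 0 < C₀ ∧ ∀ t ∈ Icc (0:ℝ) T, ∀ ω : Ω, ∀ p q x z : V, ‖z‖ = 1 →
      lam * (fderiv ℝ (fun q' : V => H t q' x ω) p p - H t p x ω) +
        iteratedFDeriv ℝ 2 (fun r : V × V => H t r.1 r.2 ω) (p, x) ![(q, z), (q, z)]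
        ≥ -C₀)

/-- Assumption (H3): the expected time modulus of continuity of `H̃` on bounded gradient
sets tends to `0`. -/
def H3Hyp (μ : Measure Ω) (T : ℝ) (H : ℝ → V → V → Ω → ℝ) : Prop :=
  ∀ R : ℝ, 0 < R → ∃ w : ℕ → Ω → ℝ,
    (∀ N : ℕ, ∀ ω : Ω, ∀ s ∈ Icc (0:ℝ) T, ∀ t ∈ Icc (0:ℝ) T, |s - t| ≤ 1 / N →
      ∀ p y : V, ‖p‖ ≤ R → |H s p y ω - H t p y ω| ≤ w N ω) ∧
    Tendsto (fun N : ℕ => ∫ ω, w N ω ∂μ) atTop (𝓝 0)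

/-- Regularity part of the definition of a solution of the backward stochastic HJ
equation: adaptedness, time continuity, uniform bounds, Lipschitz bounds and
semiconcavity in space, and the martingale property of `M`. -/
structure HJReg (μ : Measure Ω) (F : Filtration ℝ mΩ) (T : ℝ)
    (u M : ℝ → V → Ω → ℝ) : Prop where
  adapted_u : ∀ x : V, Adapted F fun t ω => u t x ω
  adapted_M : ∀ x : V, Adapted F fun t ω => M t x ω
  cont_u : ∀ᵐ ω ∂μ, ∀ x : V, ContinuousOn (fun t => u t x ω) (Icc 0 T)
  bdd : ∃ C : ℝ, 0 < C ∧ ∀ᵐ ω ∂μ, ∀ᵐ t ∂(volume.restrict (Icc (0:ℝ) T)),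
      (∀ x : V, |u t x ω| ≤ C ∧ |M t x ω| ≤ C) ∧
      LipschitzWith C.toNNReal (fun x : V => u t x ω) ∧
      SemiconcaveWith d C fun x : V => u t x ω
  mart : ∀ᵐ x ∂(volume : Measure V),
      Martingale (fun t ω => M t x ω) F μ ∧ ∀ᵐ ω ∂μ, Continuous fun t => M t x ω

/-- A solution of the backward stochastic HJ equation
`d u_t = H̃_t(Du_t, x) dt + dM̃_t`, `u_T = G̃`. -/
def IsHJSol (μ : Measure Ω) (F : Filtration ℝ mΩ) (T : ℝ)
    (H : ℝ → V → V → Ω → ℝ) (G : V → Ω → ℝ) (u M : ℝ → V → Ω → ℝ) : Prop :=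
  HJReg d μ F T u M ∧
  ∀ᵐ q ∂((volume : Measure V).prod (volume.restrict (Icc (0:ℝ) T))), ∀ᵐ ω ∂μ,
    u q.2 q.1 ω = G q.1 ω
      - (∫ s in Ioc q.2 T, H s (gradient (fun y : V => u s y ω) q.1) q.1 ω)
      - M T q.1 ω + M q.2 q.1 ω

/-- A supersolution of the backward stochastic HJ equation. -/
def IsHJSupersol (μ : Measure Ω) (F : Filtration ℝ mΩ) (T : ℝ)
    (H : ℝ → V → V → Ω → ℝ) (G : V → Ω → ℝ) (u M : ℝ → V → Ω → ℝ) : Prop :=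
  HJReg d μ F T u M ∧
  (∀ᵐ q ∂((volume : Measure V).prod
      ((volume.restrict (Icc (0:ℝ) T)).prod (volume.restrict (Icc (0:ℝ) T)))),
    q.2.1 < q.2.2 → ∀ᵐ ω ∂μ,
      u q.2.1 q.1 ω ≥ u q.2.2 q.1 ω
        - (∫ s in Ioc q.2.1 q.2.2, H s (gradient (fun y : V => u s y ω) q.1) q.1 ω)
        - M q.2.2 q.1 ω + M q.2.1 q.1 ω) ∧
  (∀ᵐ x ∂(volume : Measure V), ∀ᵐ ω ∂μ, u T x ω ≥ G x ω)

/-- A subsolution of the backward stochastic HJ equation. -/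
def IsHJSubsol (μ : Measure Ω) (F : Filtration ℝ mΩ) (T : ℝ)
    (H : ℝ → V → V → Ω → ℝ) (G : V → Ω → ℝ) (u M : ℝ → V → Ω → ℝ) : Prop :=
  HJReg d μ F T u M ∧
  (∀ᵐ q ∂((volume : Measure V).prod
      ((volume.restrict (Icc (0:ℝ) T)).prod (volume.restrict (Icc (0:ℝ) T)))),
    q.2.1 < q.2.2 → ∀ᵐ ω ∂μ,
      u q.2.1 q.1 ω ≤ u q.2.2 q.1 ω
        - (∫ s in Ioc q.2.1 q.2.2, H s (gradient (fun y : V => u s y ω) q.1) q.1 ω)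
        - M q.2.2 q.1 ω + M q.2.1 q.1 ω) ∧
  (∀ᵐ x ∂(volume : Measure V), ∀ᵐ ω ∂μ, u T x ω ≤ G x ω)

lemma slope_aux {E : Type*} [NormedAddCommGroup E] [NormedSpace ℝ E] {f : E → ℝ} {L : E →L[ℝ] ℝ}
    {y a : E} {K : ℝ} (hL : HasFDerivAt f L y)
    (h : ∀ θ : ℝ, 0 < θ → θ ≤ 1 → θ * K ≤ f (y + θ • a) - f y) : K ≤ L a := by
  have h1 : HasDerivAt (fun t : ℝ => f (y + t • a)) (L a) 0 := by
    have h2 : HasDerivAt (fun t : ℝ => y + t • a) a 0 := by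
      simpa using ((hasDerivAt_id (0:ℝ)).smul_const a).const_add y
    have h3 : HasFDerivAt f L (y + (0:ℝ) • a) := by simpa using hL
    exact h3.comp_hasDerivAt (0:ℝ) h2
  have h4 := h1.tendsto_slope_zero_right
  refine ge_of_tendsto h4 ?_
  have : Ioc (0:ℝ) 1 ∈ 𝓝[>] (0:ℝ) := Ioc_mem_nhdsGT one_pos
  filter_upwards [this] with t ht
  have := h t ht.1 ht.2
  simp only [zero_add, zero_smul, add_zero, smul_eq_mul]
  rw [← div_eq_inv_mul, le_div_iff₀ ht.1]
  linarith

lemma convex_grad_ineq {E : Type*} [NormedAddCommGroup E] [NormedSpace ℝ E] {f : E → ℝ}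
    {L : E →L[ℝ] ℝ} {y : E} (hf : ConvexOn ℝ univ f) (hL : HasFDerivAt f L y) (z : E) :
    L (z - y) ≤ f z - f y := by
  have h : f y - f z ≤ (-L) (z - y) := by
    refine slope_aux (f := -f) hL.neg ?_
    intro θ h0 h1
    have := hf.2 (mem_univ y) (mem_univ z) (by linarith : 0 ≤ 1 - θ) h0.le (by ring)
    have e : y + θ • (z - y) = (1 - θ) • y + θ • z := by module
    rw [e]
    simp only [smul_eq_mul, Pi.neg_apply] at *
    linarith
  simp only [neg_apply, map_sub] at h ⊢
  linarith

lemma semiconc_grad_ineq {C : ℝ} {f : V → ℝ} {L : V →L[ℝ] ℝ} {y : V}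
    (hf : SemiconcaveWith d C f) (hC : 0 ≤ C) (hL : HasFDerivAt f L y) (a : V) :
    f (y + a) - f y - C / 2 * ‖a‖ ^ 2 ≤ L a := by
  refine slope_aux hL ?_
  intro θ h0 h1
  have := hf (y + a) y θ h0.le h1
  have e : θ • (y + a) + (1 - θ) • y = y + θ • a := by module
  rw [e] at this
  have e2 : y + a - y = a := by abel
  rw [e2] at this
  have : 0 ≤ C / 2 * (θ * θ) * ‖a‖ ^ 2 := by positivity
  nlinarith

/-- monotone gradient gives second derivative bound -/
lemma second_deriv_bound {E : Type*} [NormedAddCommGroup E] [NormedSpace ℝ E]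
    {D : E → E →L[ℝ] ℝ} {D2 : E →L[ℝ] E →L[ℝ] ℝ} {x z : E} {C : ℝ} (hD : HasFDerivAt D D2 x)
    (h : ∀ t : ℝ, 0 < t → C * t ≤ (D (x + t • z) - D x) z) : C ≤ D2 z z := by
  have h1 : HasFDerivAt (fun y => D y z) ((ContinuousLinearMap.apply ℝ ℝ z).comp D2) x :=
    (ContinuousLinearMap.apply ℝ ℝ z).hasFDerivAt.comp x hD
  have := slope_aux (a := z) (K := C) h1 (fun θ h0 _ => by
    have := h θ h0
    simp at this
    linarith)
  simpa using this

lemma semiconc_second {C : ℝ} {f : V → ℝ} (hf : SemiconcaveWith d C f) (hC : 0 ≤ C)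
    (h2 : ContDiff ℝ 2 f) (x z : V) : fderiv ℝ (fderiv ℝ f) x z z ≤ C * ‖z‖ ^ 2 := by
  have hd : Differentiable ℝ f := h2.differentiable (by norm_num)
  have hdd : DifferentiableAt ℝ (fderiv ℝ f) x :=
    ((h2.fderiv_right (m := 1) (by norm_num)).differentiable (by norm_num)) x
  have h := second_deriv_bound (D := fun y => -fderiv ℝ f y) (C := -(C * ‖z‖ ^ 2)) (z := z)
    hdd.hasFDerivAt.neg ?_
  · simp at h; linarith
  · intro t ht
    have i1 := semiconc_grad_ineq d hf hC (hd x).hasFDerivAt (t • z)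
    have i2 := semiconc_grad_ineq d hf hC (hd (x + t • z)).hasFDerivAt (-(t • z))
    simp only [add_neg_cancel_right, norm_neg, norm_smul, map_neg, map_smul, smul_eq_mul,
      mul_pow, Real.norm_eq_abs, sq_abs] at i1 i2
    simp only [sub_apply, neg_apply]
    have : t * (-(C * ‖z‖ ^ 2) * t) ≤ t * ( - fderiv ℝ f (x + t • z) z - - fderiv ℝ f x z) := by
      nlinarith
    exact le_of_mul_le_mul_left this ht

lemma convex_second {E : Type*} [NormedAddCommGroup E] [NormedSpace ℝ E] {f : E → ℝ}
    (hf : ConvexOn ℝ univ f)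
    (h2 : ContDiff ℝ 2 f) (x z : E) : 0 ≤ fderiv ℝ (fderiv ℝ f) x z z := by
  have hd : Differentiable ℝ f := h2.differentiable (by norm_num)
  have hdd : DifferentiableAt ℝ (fderiv ℝ f) x :=
    ((h2.fderiv_right (m := 1) (by norm_num)).differentiable (by norm_num)) x
  refine second_deriv_bound (z := z) hdd.hasFDerivAt ?_
  intro t ht
  have i1 := convex_grad_ineq hf (hd x).hasFDerivAt (x + t • z)
  have i2 := convex_grad_ineq hf (hd (x + t • z)).hasFDerivAt x
  have e1 : x + t • z - x = t • z := by abel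
  have e2 : x - (x + t • z) = -(t • z) := by abel
  rw [e1] at i1
  rw [e2] at i2
  simp only [map_neg, map_smul, smul_eq_mul] at i1 i2
  simp only [sub_apply]
  have : t * (0 * t) ≤ t * (fderiv ℝ f (x + t • z) z - fderiv ℝ f x z) := by
    nlinarith
  exact le_of_mul_le_mul_left this ht

open scoped MatrixOrder Matrix.Norms.L2Operator in
lemma psd_factor {n : ℕ} (A : Matrix (Fin n) (Fin n) ℝ) (hA : A.PosSemidef) :
    ∃ S : Matrix (Fin n) (Fin n) ℝ, A = S.transpose * S := by
  obtain ⟨S, hS⟩ := CStarAlgebra.nonneg_iff_eq_star_mul_self.mp hA.nonneg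
  refine ⟨S, ?_⟩
  rw [hS, Matrix.star_eq_conjTranspose, Matrix.conjTranspose_eq_transpose_of_trivial]

lemma trace_bound {n : ℕ} (A B : Matrix (Fin n) (Fin n) ℝ) (hA : A.PosSemidef) (C : ℝ)
    (hB : ∀ v : Fin n → ℝ, v ⬝ᵥ (B.mulVec v) ≤ C * (v ⬝ᵥ v)) :
    (A * B).trace ≤ C * A.trace := by
  obtain ⟨S, hS'⟩ := psd_factor A hA
  rw [hS', Matrix.mul_assoc, Matrix.trace_mul_comm, Matrix.trace_mul_comm S.transpose S]
  simp only [Matrix.trace, Matrix.diag, Finset.mul_sum]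
  refine Finset.sum_le_sum fun k _ => ?_
  have := hB (S k)
  have e1 : (S * B * S.transpose) k k = (S k) ⬝ᵥ (B.mulVec (S k)) := by
    rw [Matrix.mul_assoc]; rfl
  have e2 : (S * S.transpose) k k = (S k) ⬝ᵥ (S k) := by
    simp [Matrix.mul_apply, dotProduct]
  rw [e1, e2]
  exact this

lemma bilin_trace (A S : V →L[ℝ] V →L[ℝ] ℝ) (T : V →L[ℝ] V) (hT : ∀ z y, ⟪T z, y⟫ = S z y)
    (hsym : ∀ x y, A x y = A y x) (hpos : ∀ x, 0 ≤ A x x) {B C : ℝ} (hA : ‖A‖ ≤ B) (hC : 0 ≤ C)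
    (hS : ∀ z, S z z ≤ C * ‖z‖ ^ 2) :
    ∑ i, A (T (EuclideanSpace.basisFun (Fin d) ℝ i)) (EuclideanSpace.basisFun (Fin d) ℝ i)
      ≤ C * (d * B) := by
  set b := EuclideanSpace.basisFun (Fin d) ℝ with hb
  let MA : Matrix (Fin d) (Fin d) ℝ := fun i j => A (b i) (b j)
  let MS : Matrix (Fin d) (Fin d) ℝ := fun i j => S (b i) (b j)
  have hsum : ∀ v : Fin d → ℝ, ∀ (Q : V →L[ℝ] V →L[ℝ] ℝ),
      v ⬝ᵥ (Matrix.mulVec (fun i j => Q (b i) (b j)) v)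
        = Q (∑ i, v i • b i) (∑ i, v i • b i) := by
    intro v Q
    simp [dotProduct, Matrix.mulVec, Finset.mul_sum, map_sum]
    rw [Finset.sum_comm]
    refine Finset.sum_congr rfl fun i _ => Finset.sum_congr rfl fun j _ => by ring
  have hnorm : ∀ v : Fin d → ℝ, ‖∑ i, v i • b i‖ ^ 2 = v ⬝ᵥ v := by
    intro v
    have : ∑ i, v i • b i = WithLp.toLp 2 v := by
      ext j
      simp [hb, Finset.sum_apply, Pi.single_apply]
    rw [this, EuclideanSpace.norm_sq_eq]
    simp [dotProduct, sq]
  have hPSD : MA.PosSemidef := by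
    refine Matrix.PosSemidef.of_dotProduct_mulVec_nonneg ?_ ?_
    · ext i j
      rw [Matrix.conjTranspose_apply]
      simp [MA, hsym (b i) (b j)]
    · intro v
      have := hsum v A
      simp only [star_trivial]
      change 0 ≤ v ⬝ᵥ (Matrix.mulVec (fun i j => A (b i) (b j)) v)
      rw [this]
      exact hpos _
  have h1 := trace_bound MA MS hPSD C (fun v => by
    have := hsum v S
    change v ⬝ᵥ (Matrix.mulVec (fun i j => S (b i) (b j)) v) ≤ _
    rw [this, ← hnorm]
    exact hS _)
  have h2 : MA.trace ≤ d * B := by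
    have : ∀ i, MA i i ≤ B := by
      intro i
      have h := A.le_opNorm₂ (b i) (b i)
      rw [b.norm_eq_one, mul_one, mul_one] at h
      exact (le_abs_self _).trans (h.trans hA)
    calc MA.trace = ∑ i, MA i i := rfl
      _ ≤ ∑ i : Fin d, B := Finset.sum_le_sum fun i _ => this i
      _ = d * B := by simp
  have h3 : ∑ i, A (T (b i)) (b i) = (MA * MS).trace := by
    have : ∀ i, T (b i) = ∑ j, MS i j • b j := by
      intro i
      rw [← b.sum_repr (T (b i))]
      refine Finset.sum_congr rfl fun j _ => ?_
      rw [b.repr_apply_apply, real_inner_comm, hT]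
    simp only [this, map_sum, map_smul, sum_apply,
      Matrix.trace, Matrix.diag, Matrix.mul_apply]
    rw [Finset.sum_comm]
    refine Finset.sum_congr rfl fun j _ => ?_
    refine Finset.sum_congr rfl fun i _ => ?_
    simp [MA, mul_comm]
  rw [h3]
  exact h1.trans (mul_le_mul_of_nonneg_left h2 hC)
lemma gradient_inner {f : V → ℝ} (x a : V) : ⟪gradient f x, a⟫ = fderiv ℝ f x a := by
  rw [← toDual_gradient]; rfl

lemma tendsto_of_inner {ι : Type*} {l : Filter ι} {p : ι → V} {q : V}
    (h : ∀ a : V, Tendsto (fun n => ⟪p n, a⟫) l (𝓝 ⟪q, a⟫)) : Tendsto p l (𝓝 q) := by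
  have h1 : Tendsto (fun n => WithLp.ofLp (p n)) l (𝓝 (WithLp.ofLp q)) := by
    rw [tendsto_pi_nhds]
    intro i
    have := h (EuclideanSpace.basisFun (Fin d) ℝ i)
    simpa [EuclideanSpace.inner_single_right] using this
  have h2 := ((PiLp.continuous_toLp 2 (fun _ : Fin d => ℝ)).tendsto _).comp h1
  simpa [Function.comp_def] using h2

lemma grad_tendsto_aux {u : V → ℝ} {un : ℕ → V → ℝ} {C : ℝ} (hC : 0 ≤ C) {x : V}
    (hn : ∀ n, DifferentiableAt ℝ (un n) x) (hs : ∀ n, SemiconcaveWith d C (un n))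
    (hlim : ∀ y, Tendsto (fun n => un n y) atTop (𝓝 (u y))) (hu : DifferentiableAt ℝ u x)
    (a : V) (c : ℝ) (hc : c < fderiv ℝ u x a) : ∀ᶠ n in atTop, c < fderiv ℝ (un n) x a := by
  have h1 : HasDerivAt (fun t : ℝ => u (x + t • a)) (fderiv ℝ u x a) 0 := by
    have h2 : HasDerivAt (fun t : ℝ => x + t • a) a 0 := by
      simpa using ((hasDerivAt_id (0:ℝ)).smul_const a).const_add x
    have h3 : HasFDerivAt u (fderiv ℝ u x) (x + (0:ℝ) • a) := by simpa using hu.hasFDerivAt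
    exact h3.comp_hasDerivAt (0:ℝ) h2
  have h4 := h1.tendsto_slope_zero_right
  have h5 : Tendsto (fun t : ℝ => C / 2 * t * ‖a‖ ^ 2) (𝓝[>] 0) (𝓝 0) := by
    have : Continuous (fun t : ℝ => C / 2 * t * ‖a‖ ^ 2) := by fun_prop
    have := this.tendsto 0
    simp only [mul_zero, zero_mul] at this
    exact this.mono_left nhdsWithin_le_nhds
  have h6 := h4.sub h5
  rw [sub_zero] at h6
  have h7 := (h6.eventually (lt_mem_nhds hc)).and self_mem_nhdsWithin
  obtain ⟨t, ht, ht0⟩ := h7.exists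
  have ht0 : 0 < t := ht0
  simp only [zero_add, zero_smul, add_zero, smul_eq_mul] at ht
  have h8 : Tendsto (fun n => t⁻¹ * (un n (x + t • a) - un n x) - C / 2 * t * ‖a‖ ^ 2) atTop
      (𝓝 (t⁻¹ * (u (x + t • a) - u x) - C / 2 * t * ‖a‖ ^ 2)) :=
    (((hlim _).sub (hlim _)).const_mul _).sub_const _
  filter_upwards [h8.eventually (lt_mem_nhds ht)] with n hcn
  refine hcn.trans_le ?_
  have := semiconc_grad_ineq d (hs n) hC (hn n).hasFDerivAt (t • a)
  simp only [norm_smul, map_smul, smul_eq_mul, mul_pow, Real.norm_eq_abs, sq_abs] at this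
  rw [← div_eq_inv_mul, sub_le_iff_le_add, div_le_iff₀ ht0]
  nlinarith

lemma mollify {u : V → ℝ} {L : ℝ≥0} (hu : LipschitzWith L u) {C : ℝ} (hC : 0 ≤ C)
    (hs : SemiconcaveWith d C u) : ∃ un : ℕ → V → ℝ, (∀ n, ContDiff ℝ 2 (un n)) ∧
      (∀ n, LipschitzWith L (un n)) ∧ (∀ n, SemiconcaveWith d C (un n)) ∧
      ∀ x, DifferentiableAt ℝ u x →
        Tendsto (fun n => gradient (un n) x) atTop (𝓝 (gradient u x)) := by
  let φ : ℕ → ContDiffBump (0 : V) := fun n =>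
    ⟨1 / (n + 1) / 2, 1 / (n + 1), by positivity, half_lt_self (by positivity)⟩
  let un : ℕ → V → ℝ := fun n =>
    convolution ((φ n).normed volume) u (ContinuousLinearMap.lsmul ℝ ℝ) volume
  have hun : ∀ n x, un n x = ∫ t, (φ n).normed volume t * u (x - t) := by
    intro n x
    simp [un, convolution_def]
  have hint : ∀ n x, Integrable (fun t => (φ n).normed volume t * u (x - t)) volume := by
    intro n x
    refine Continuous.integrable_of_hasCompactSupport ?_ ?_
    · exact (φ n).continuous_normed.mul (hu.continuous.comp (by fun_prop))
    · exact (φ n).hasCompactSupport_normed.mul_right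
  have h1 : ∀ n, ∫ t, (φ n).normed volume t = 1 := fun n => (φ n).integral_normed
  have hi1 : ∀ n, Integrable (fun t => (φ n).normed volume t) volume := fun n =>
    (φ n).integrable_normed
  have hcd : ∀ n, ContDiff ℝ 2 (un n) := fun n =>
    (φ n).hasCompactSupport_normed.contDiff_convolution_left _ (φ n).contDiff_normed
      hu.continuous.locallyIntegrable
  have hsc : ∀ n, SemiconcaveWith d C (un n) := by
    intro n x y θ h0 hθ
    have hadd : Integrable (fun t => θ * ((φ n).normed volume t * u (x - t)) +
        (1 - θ) * ((φ n).normed volume t * u (y - t))) volume :=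
      ((hint n x).const_mul _).add ((hint n y).const_mul _)
    rw [hun, hun, hun, ← integral_const_mul, ← integral_const_mul,
      ← integral_add ((hint n x).const_mul _) ((hint n y).const_mul _),
      ← integral_sub hadd (hint n _)]
    calc _ ≤ ∫ t, (φ n).normed volume t * (C / 2 * (θ * (1 - θ)) * ‖x - y‖ ^ 2) := by
          refine integral_mono (hadd.sub (hint n _)) ((hi1 n).mul_const _) ?_
          intro t
          have := hs (x - t) (y - t) θ h0 hθ
          have e1 : θ • (x - t) + (1 - θ) • (y - t) = θ • x + (1 - θ) • y - t := by module
          have e2 : x - t - (y - t) = x - y := by abel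
          rw [e1, e2] at this
          have := mul_le_mul_of_nonneg_left this ((φ n).nonneg_normed (μ := volume) t)
          dsimp
          linarith
      _ = _ := by rw [integral_mul_const, h1, one_mul]
  refine ⟨un, hcd, ?_, hsc, ?_⟩
  · intro n
    refine LipschitzWith.of_dist_le_mul fun x y => ?_
    rw [hun, hun, dist_eq_norm, ← integral_sub (hint n x) (hint n y)]
    calc _ ≤ ∫ t, (φ n).normed volume t * (L * dist x y) := by
          refine norm_integral_le_of_norm_le ((hi1 n).mul_const _) (Eventually.of_forall ?_)
          intro t
          rw [← mul_sub, norm_mul, Real.norm_of_nonneg ((φ n).nonneg_normed (μ := volume) t)]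
          refine mul_le_mul_of_nonneg_left ?_ ((φ n).nonneg_normed (μ := volume) t)
          have := hu.dist_le_mul (x - t) (y - t)
          rw [dist_sub_right] at this
          rwa [← dist_eq_norm]
      _ = _ := by rw [integral_mul_const, h1, one_mul]
  · intro x hx
    have hlim : ∀ y, Tendsto (fun n => un n y) atTop (𝓝 (u y)) := by
      intro y
      exact ContDiffBump.convolution_tendsto_right_of_continuous
        tendsto_one_div_add_atTop_nhds_zero_nat hu.continuous y
    refine tendsto_of_inner d fun a => ?_
    simp only [gradient_inner]
    have hdn : ∀ n, DifferentiableAt ℝ (un n) x := fun n =>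
      (hcd n).differentiable (by norm_num) x
    refine tendsto_order.2 ⟨fun c hc => ?_, fun c hc => ?_⟩
    · exact grad_tendsto_aux d hC hdn hsc hlim hx a c hc
    · have := grad_tendsto_aux d hC hdn hsc hlim hx (-a) (-c) (by simpa using hc)
      filter_upwards [this] with n h
      simpa using h

def posq (x : ℝ) : ℝ := (max x 0) ^ 2

lemma posq_hasDerivAt (x : ℝ) : HasDerivAt posq (2 * max x 0) x := by
  rcases lt_trichotomy x 0 with h | h | h
  · rw [max_eq_right h.le, mul_zero]
    refine (hasDerivAt_const x (0:ℝ)).congr_of_eventuallyEq ?_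
    filter_upwards [gt_mem_nhds h] with y hy
    simp [posq, max_eq_right hy.le]
  · subst h
    rw [hasDerivAt_iff_tendsto_slope_zero]
    have : Tendsto (fun t : ℝ => max t 0) (𝓝[≠] 0) (𝓝 (max 0 0)) :=
      ((continuous_id.max continuous_const).tendsto 0).mono_left nhdsWithin_le_nhds
    simp only [max_self, mul_zero] at this ⊢
    refine this.congr' ?_
    filter_upwards [self_mem_nhdsWithin] with t ht
    have ht : t ≠ 0 := ht
    simp only [posq, zero_add, max_self, smul_eq_mul]
    rcases le_total t 0 with h | h
    · simp [max_eq_right h]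
    · rw [max_eq_left h]; field_simp; simp
  · rw [max_eq_left h.le]
    have : HasDerivAt (fun y : ℝ => y ^ 2) (2 * x) x := by simpa using hasDerivAt_pow 2 x
    refine this.congr_of_eventuallyEq ?_
    filter_upwards [lt_mem_nhds h] with y hy
    simp [posq, max_eq_left hy.le]

lemma posq_contDiff : ContDiff ℝ 1 posq := by
  rw [contDiff_one_iff_deriv]
  refine ⟨fun x => (posq_hasDerivAt x).differentiableAt, ?_⟩
  have : deriv posq = fun x => 2 * max x 0 := funext fun x => (posq_hasDerivAt x).deriv
  rw [this]
  fun_prop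

lemma posq_nonneg (x : ℝ) : 0 ≤ posq x := sq_nonneg _

lemma posq_convex (x y : ℝ) : posq x + 2 * max x 0 * (y - x) ≤ posq y := by
  unfold posq
  rcases le_total x 0 with h | h <;> rcases le_total y 0 with h' | h' <;> simp [h, h'] <;> nlinarith [sq_nonneg (x - y)]

lemma posq_eq_zero {x : ℝ} : posq x = 0 ↔ x ≤ 0 := by
  simp [posq]

lemma posq_diff {x y C : ℝ} (hx : |x| ≤ C) (hy : |y| ≤ C) : |posq x - posq y| ≤ 2 * C * |x - y| := by
  unfold posq
  have e : max x 0 ^ 2 - max y 0 ^ 2 = (max x 0 + max y 0) * (max x 0 - max y 0) := by ring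
  rw [e, abs_mul]
  have h1 : |max x 0 + max y 0| ≤ 2 * C := by
    have := abs_le.1 hx; have := abs_le.1 hy
    have hC : 0 ≤ C := (abs_nonneg _).trans hx
    rw [abs_of_nonneg (by positivity)]
    have : max x 0 ≤ C := max_le (by linarith) hC
    have : max y 0 ≤ C := max_le (by linarith) hC
    linarith
  have h2 : |max x 0 - max y 0| ≤ |x - y| := abs_max_sub_max_le_abs x y 0
  exact mul_le_mul h1 h2 (abs_nonneg _) ((abs_nonneg _).trans h1)

/-- weight -/
lemma exists_weight : ∃ (ψ : V → ℝ) (c : ℝ), ContDiff ℝ 1 ψ ∧ (∀ x, 0 < ψ x) ∧ (∀ x, ψ x ≤ 1) ∧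
    (0 ≤ c) ∧ (∀ x, ‖fderiv ℝ ψ x‖ ≤ c * ψ x) ∧ Integrable (fun x => ψ x ^ 2) volume ∧
    ∀ δ > 0, Bornology.IsBounded {x | δ ≤ ψ x} := by
  have hpos : ∀ x : V, 0 < 1 + ‖x‖ ^ 2 := fun x => by positivity
  refine ⟨fun x => ((1 + ‖x‖ ^ 2) ^ (d + 1))⁻¹, d + 1, ?_, ?_, ?_, by positivity, ?_, ?_, ?_⟩
  · refine ContDiff.inv ?_ fun x => (pow_pos (hpos x) _).ne'
    exact (contDiff_const.add (contDiff_norm_sq ℝ)).pow _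
  · intro x; have := hpos x; positivity
  · intro x
    refine inv_le_one_of_one_le₀ (one_le_pow₀ ?_)
    have : 0 ≤ ‖x‖ ^ 2 := by positivity
    linarith
  · intro x
    have h1 : HasFDerivAt (fun x : V => 1 + ‖x‖ ^ 2) (2 • innerSL ℝ x) x :=
      ((hasStrictFDerivAt_norm_sq x).hasFDerivAt).const_add 1
    have h2 : HasDerivAt (fun y : ℝ => (y ^ (d + 1))⁻¹)
        (-(((d + 1 : ℕ) : ℝ) * (1 + ‖x‖ ^ 2) ^ d) / ((1 + ‖x‖ ^ 2) ^ (d + 1)) ^ 2) (1 + ‖x‖ ^ 2) := by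
      have h := hasDerivAt_pow (𝕜 := ℝ) (d + 1) (1 + ‖x‖ ^ 2)
      have := HasDerivAt.fun_inv h (pow_pos (hpos x) _).ne'
      simpa using this
    have h3 := h2.comp_hasFDerivAt x h1
    have h3' : fderiv ℝ (fun x : V => ((1 + ‖x‖ ^ 2) ^ (d + 1))⁻¹) x = _ := h3.fderiv
    rw [h3', norm_smul]
    have h4 : ‖(2 • innerSL ℝ x : V →L[ℝ] ℝ)‖ ≤ 2 * ‖x‖ := by
      refine (norm_nsmul_le).trans ?_
      simp
    refine (mul_le_mul_of_nonneg_left h4 (norm_nonneg _)).trans ?_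
    have hp := hpos x
    rw [norm_div, norm_neg, Real.norm_of_nonneg (by positivity), Real.norm_of_nonneg (by positivity)]
    set A := 1 + ‖x‖ ^ 2 with hA
    have h5 : 2 * ‖x‖ ≤ A := by nlinarith [sq_nonneg (‖x‖ - 1)]
    have : ((d + 1 : ℕ) : ℝ) * A ^ d / (A ^ (d + 1)) ^ 2 * A = (d + 1) * (A ^ (d + 1))⁻¹ := by
      push_cast
      field_simp
      ring
    rw [← this]
    exact mul_le_mul_of_nonneg_left h5 (by positivity)
  · have h := integrable_rpow_neg_one_add_norm_sq (E := V) (μ := volume) (r := 4 * (d + 1))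
      (by simp; linarith)
    refine h.congr (Eventually.of_forall fun x => ?_)
    dsimp
    have : -(4 * ((d : ℝ) + 1)) / 2 = -((2 * (d + 1) : ℕ) : ℝ) := by push_cast; ring
    rw [this, Real.rpow_neg (hpos x).le, Real.rpow_natCast, inv_pow, ← pow_mul, mul_comm]
  · intro δ hδ
    refine (Metric.isBounded_closedBall (x := (0:V)) (r := δ⁻¹)).subset fun x hx => ?_
    have hx : δ ≤ ((1 + ‖x‖ ^ 2) ^ (d + 1))⁻¹ := hx
    rw [mem_closedBall_zero_iff]
    have h1 : (1 + ‖x‖ ^ 2) ^ (d + 1) ≤ δ⁻¹ := by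
      rw [le_inv_comm₀ (by have := hpos x; positivity) hδ]; exact hx
    have h2 : (1 + ‖x‖ ^ 2) ≤ (1 + ‖x‖ ^ 2) ^ (d + 1) :=
      le_self_pow₀ (by have : 0 ≤ ‖x‖ ^ 2 := by positivity
                       linarith) (by omega)
    nlinarith [sq_nonneg (‖x‖ - 1)]
lemma contDiff_DpH {h : V → V → ℝ} (hh : ContDiff ℝ 2 fun q : V × V => h q.1 q.2) :
    ContDiff ℝ 1 (fun q : V × V => fderiv ℝ (fun r => h r q.2) q.1) := by
  have h1 : ContDiff ℝ 2 (Function.uncurry (fun (q : V × V) (r : V) => h r q.2)) := by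
    have : ContDiff ℝ 2 (fun z : (V × V) × V => (z.2, z.1.2)) := by fun_prop
    exact hh.comp this
  exact ContDiff.fderiv (f := fun (q : V × V) (r : V) => h r q.2) h1 contDiff_fst (by norm_num)

lemma contDiff_gradient {u : V → ℝ} (hu : ContDiff ℝ 2 u) : ContDiff ℝ 1 (gradient u) := by
  have h1 : ContDiff ℝ 1 (fderiv ℝ u) := hu.fderiv_right (by norm_num)
  exact (InnerProductSpace.toDual ℝ V).symm.contDiff.comp h1

def betaF (h : V → V → ℝ) (p : V → V) (x : V) : V →L[ℝ] ℝ := fderiv ℝ (fun r => h r x) (p x)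

lemma contDiff_beta {h : V → V → ℝ} (hh : ContDiff ℝ 2 fun q : V × V => h q.1 q.2)
    {u : V → ℝ} (hu : ContDiff ℝ 2 u) : ContDiff ℝ 1 (betaF d h (gradient u)) :=
  (contDiff_DpH d hh).comp ((contDiff_gradient d hu).prodMk contDiff_id)

lemma div_beta_le {h : V → V → ℝ} (hh : ContDiff ℝ 2 fun q : V × V => h q.1 q.2)
    (hconv : ∀ x, ConvexOn ℝ univ fun p => h p x)
    {u : V → ℝ} (hu : ContDiff ℝ 2 u) {C B : ℝ} (hC : 0 ≤ C) (hs : SemiconcaveWith d C u) (x : V)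
    (hB1 : ‖fderiv ℝ (fun y : V => fderiv ℝ (fun q : V => h q y) (gradient u x)) x‖ ≤ B)
    (hB2 : ‖iteratedFDeriv ℝ 2 (fun q : V => h q x) (gradient u x)‖ ≤ B) :
    ∑ i, fderiv ℝ (betaF d h (gradient u)) x (EuclideanSpace.basisFun (Fin d) ℝ i)
      (EuclideanSpace.basisFun (Fin d) ℝ i) ≤ C * (d * B) + d * B := by
  set b := EuclideanSpace.basisFun (Fin d) ℝ with hb
  set P : V × V → V →L[ℝ] ℝ := fun q => fderiv ℝ (fun r => h r q.2) q.1 with hP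
  set p := gradient u x with hp
  have hPd : HasFDerivAt P (fderiv ℝ P (p, x)) (p, x) :=
    ((contDiff_DpH d hh).differentiable (by norm_num) (p, x)).hasFDerivAt
  set T := fderiv ℝ (gradient u) x with hT
  have hTd : HasFDerivAt (gradient u) T x :=
    ((contDiff_gradient d hu).differentiable (by norm_num) x).hasFDerivAt
  have hβ : HasFDerivAt (betaF d h (gradient u))
      ((fderiv ℝ P (p, x)).comp (T.prod (ContinuousLinearMap.id ℝ V))) x :=
    HasFDerivAt.comp x (g := P) (f := fun y => (gradient u y, y)) hPd (hTd.prodMk (hasFDerivAt_id x))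
  have hA : HasFDerivAt (fun q => fderiv ℝ (fun r => h r x) q)
      ((fderiv ℝ P (p, x)).comp (ContinuousLinearMap.inl ℝ V V)) p :=
    HasFDerivAt.comp p (g := P) (f := fun q => (q, x)) hPd (hasFDerivAt_prodMk_left p x)
  have hX : HasFDerivAt (fun y => fderiv ℝ (fun r => h r y) p)
      ((fderiv ℝ P (p, x)).comp (ContinuousLinearMap.inr ℝ V V)) x :=
    HasFDerivAt.comp x (g := P) (f := fun y => (p, y)) hPd (hasFDerivAt_prodMk_right p x)
  set A := fderiv ℝ (fderiv ℝ (fun r => h r x)) p with hAdef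
  have hA' : A = (fderiv ℝ P (p, x)).comp (ContinuousLinearMap.inl ℝ V V) := hA.fderiv
  set Xd := fderiv ℝ (fun y => fderiv ℝ (fun r => h r y) p) x with hXdef
  have hX' : Xd = (fderiv ℝ P (p, x)).comp (ContinuousLinearMap.inr ℝ V V) := hX.fderiv
  have hsplit : ∀ z, fderiv ℝ (betaF d h (gradient u)) x z = A (T z) + Xd z := by
    intro z
    rw [hβ.fderiv, hA', hX']
    simp only [ContinuousLinearMap.comp_apply, ← map_add]
    simp
  have hhx : ContDiff ℝ 2 (fun r => h r x) :=
    hh.comp (by fun_prop : ContDiff ℝ 2 fun r : V => (r, x))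
  have hAn : ‖A‖ ≤ B := by
    have : ‖A‖ = ‖iteratedFDeriv ℝ 2 (fun q : V => h q x) p‖ := by
      rw [hAdef, ← norm_iteratedFDeriv_one, norm_iteratedFDeriv_fderiv]
    rw [this]; exact hB2
  have hsym : ∀ y z, A y z = A z y := by
    intro y z
    have := (hhx.contDiffAt (x := p)).isSymmSndFDerivAt (by simp)
    exact this y z
  have hpos : ∀ z, 0 ≤ A z z := convex_second (hconv x) hhx p
  have hTS : ∀ z y, ⟪T z, y⟫ = fderiv ℝ (fderiv ℝ u) x z y := by
    intro z y
    have h1 : HasFDerivAt (fun x' => ⟪gradient u x', y⟫) ((innerSL ℝ y).comp T) x := by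
      have := (innerSL ℝ y).hasFDerivAt.comp x hTd
      refine this.congr_of_eventuallyEq (Eventually.of_forall fun x' => ?_)
      simp
    have h2 : HasFDerivAt (fun x' => fderiv ℝ u x' y)
        ((ContinuousLinearMap.apply ℝ ℝ y).comp (fderiv ℝ (fderiv ℝ u) x)) x :=
      (ContinuousLinearMap.apply ℝ ℝ y).hasFDerivAt.comp x
        (((hu.fderiv_right (m := 1) (by norm_num)).differentiable (by norm_num)) x).hasFDerivAt
    simp only [gradient_inner] at h1
    have := congrArg (fun l : V →L[ℝ] ℝ => l z) (h1.unique h2)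
    simpa [real_inner_comm] using this
  have h1 := bilin_trace d A (fderiv ℝ (fderiv ℝ u) x) T hTS hsym hpos hAn hC
    (semiconc_second d hs hC hu x)
  have h2 : ∑ i, Xd (b i) (b i) ≤ d * B := by
    have : ∀ i, Xd (b i) (b i) ≤ B := by
      intro i
      have h := Xd.le_opNorm₂ (b i) (b i)
      rw [b.norm_eq_one, mul_one, mul_one] at h
      exact (le_abs_self _).trans (h.trans hB1)
    calc _ ≤ ∑ i : Fin d, B := Finset.sum_le_sum fun i _ => this i
      _ = d * B := by simp
  calc _ = ∑ i, (A (T (b i)) (b i) + Xd (b i) (b i)) := by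
        refine Finset.sum_congr rfl fun i _ => ?_
        rw [hsplit]; rfl
    _ ≤ _ := by rw [Finset.sum_add_distrib]; exact add_le_add h1 h2

/-- Bounds on the Hamiltonian -/
structure HamBd (h : V → V → ℝ) (R B : ℝ) : Prop where
  smooth : ContDiff ℝ 2 fun q : V × V => h q.1 q.2
  conv : ∀ x, ConvexOn ℝ univ fun p => h p x
  bd : ∀ p x : V, ‖p‖ ≤ R →
      |h p x| + ‖fderiv ℝ (fun q : V => h q x) p‖ +
        ‖fderiv ℝ (fun y : V => fderiv ℝ (fun q : V => h q y) p) x‖ +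
        ‖iteratedFDeriv ℝ 2 (fun q : V => h q x) p‖ ≤ B

lemma HamBd.bd0 {h : V → V → ℝ} {R B : ℝ} (H : HamBd d h R B) {p x : V} (hp : ‖p‖ ≤ R) :
    |h p x| ≤ B := by
  have := H.bd p x hp
  have h2 := norm_nonneg (fderiv ℝ (fun q : V => h q x) p)
  have h3 := norm_nonneg (fderiv ℝ (fun y : V => fderiv ℝ (fun q : V => h q y) p) x)
  have h4 := norm_nonneg (iteratedFDeriv ℝ 2 (fun q : V => h q x) p)
  linarith

lemma HamBd.bd1 {h : V → V → ℝ} {R B : ℝ} (H : HamBd d h R B) {p x : V} (hp : ‖p‖ ≤ R) :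
    ‖fderiv ℝ (fun q : V => h q x) p‖ ≤ B := by
  have := H.bd p x hp
  have h2 := abs_nonneg (h p x)
  have h3 := norm_nonneg (fderiv ℝ (fun y : V => fderiv ℝ (fun q : V => h q y) p) x)
  have h4 := norm_nonneg (iteratedFDeriv ℝ 2 (fun q : V => h q x) p)
  linarith

lemma HamBd.bd2 {h : V → V → ℝ} {R B : ℝ} (H : HamBd d h R B) {p x : V} (hp : ‖p‖ ≤ R) :
    ‖fderiv ℝ (fun y : V => fderiv ℝ (fun q : V => h q y) p) x‖ ≤ B := by
  have := H.bd p x hp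
  have h2 := abs_nonneg (h p x)
  have h3 := norm_nonneg (fderiv ℝ (fun q : V => h q x) p)
  have h4 := norm_nonneg (iteratedFDeriv ℝ 2 (fun q : V => h q x) p)
  linarith

lemma HamBd.bd3 {h : V → V → ℝ} {R B : ℝ} (H : HamBd d h R B) {p x : V} (hp : ‖p‖ ≤ R) :
    ‖iteratedFDeriv ℝ 2 (fun q : V => h q x) p‖ ≤ B := by
  have := H.bd p x hp
  have h2 := abs_nonneg (h p x)
  have h3 := norm_nonneg (fderiv ℝ (fun q : V => h q x) p)
  have h4 := norm_nonneg (fderiv ℝ (fun y : V => fderiv ℝ (fun q : V => h q y) p) x)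
  linarith

lemma norm_gradient_le {u : V → ℝ} {L : ℝ≥0} (hu : LipschitzWith L u) (x : V) :
    ‖gradient u x‖ ≤ L := by
  have := norm_fderiv_le_of_lipschitz ℝ hu (x₀ := x)
  rwa [← toDual_gradient, LinearIsometryEquiv.norm_map] at this

structure Weight (ψ : V → ℝ) (c : ℝ) : Prop where
  smooth : ContDiff ℝ 1 ψ
  pos : ∀ x, 0 < ψ x
  le_one : ∀ x, ψ x ≤ 1
  c0 : 0 ≤ c
  grad : ∀ x, ‖fderiv ℝ ψ x‖ ≤ c * ψ x
  int : Integrable (fun x => ψ x ^ 2) volume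
  bdd : ∀ δ > 0, Bornology.IsBounded {x | δ ≤ ψ x}

lemma ibp_core {ψ : V → ℝ} {c : ℝ} (hψ : Weight d ψ c) {h : V → V → ℝ} {L : ℝ≥0} {B C : ℝ}
    (hB : 0 ≤ B) (hH : HamBd d h L B)
    {u : V → ℝ} (hu : ContDiff ℝ 2 u) (huL : LipschitzWith L u) (hC : 0 ≤ C)
    (hs : SemiconcaveWith d C u)
    {w : V → ℝ} {Lw : ℝ≥0} {cw : ℝ} (hw : LipschitzWith Lw w) (hwb : ∀ x, |w x| ≤ cw)
    {δ : ℝ} (hδ : 0 < δ) :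
    -(C * (d * B) + d * B + d * (2 * c * B)) * ∫ x, ψ x ^ 2 * posq (w x) ≤
      ∫ x, posq (ψ x - δ) * (2 * max (w x) 0 * betaF d h (gradient u) x (gradient w x)) := by
  set b := EuclideanSpace.basisFun (Fin d) ℝ with hb
  set β := betaF d h (gradient u) with hβ
  set K1 := C * (d * B) + d * B with hK1
  have hcw : 0 ≤ cw := (abs_nonneg _).trans (hwb 0)
  have hβC : ContDiff ℝ 1 β := contDiff_beta d hH.smooth hu
  have hβn : ∀ x, ‖β x‖ ≤ B := fun x => hH.bd1 d (norm_gradient_le d huL x)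
  let ψδ : V → ℝ := fun x => posq (ψ x - δ)
  have hψδC : ContDiff ℝ 1 ψδ := posq_contDiff.comp (hψ.smooth.sub contDiff_const)
  have hψδs : HasCompactSupport ψδ := by
    refine HasCompactSupport.of_support_subset_isCompact
      (K := closure {x | δ ≤ ψ x}) (hψ.bdd δ hδ).isCompact_closure ?_
    intro x hx
    refine subset_closure ?_
    by_contra hc
    have hc : ¬ (δ ≤ ψ x) := hc
    exact hx (posq_eq_zero.2 (by linarith))
  have hψδ0 : ∀ x, 0 ≤ ψδ x := fun x => posq_nonneg _
  have hmax : ∀ x, max (ψ x - δ) 0 ≤ ψ x := fun x => max_le (by linarith) (hψ.pos x).le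
  have hψδle : ∀ x, ψδ x ≤ ψ x ^ 2 := fun x => by
    exact pow_le_pow_left₀ (le_max_right _ _) (hmax x) 2
  have hψδd : ∀ x, ‖fderiv ℝ ψδ x‖ ≤ 2 * c * ψ x ^ 2 := by
    intro x
    have h1 : HasFDerivAt ψδ ((2 * max (ψ x - δ) 0) • fderiv ℝ ψ x) x :=
      HasDerivAt.comp_hasFDerivAt (h₂ := posq) (f := fun y => ψ y - δ) x (posq_hasDerivAt (ψ x - δ))
        ((hψ.smooth.differentiable (by norm_num) x).hasFDerivAt.sub_const δ)
    rw [h1.fderiv, norm_smul, Real.norm_of_nonneg (by positivity)]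
    have h2 := hψ.grad x
    have h3 := hmax x
    have h4 := hψ.pos x
    have h5 := hψ.c0
    have : max (ψ x - δ) 0 * ‖fderiv ℝ ψ x‖ ≤ ψ x * (c * ψ x) :=
      mul_le_mul h3 h2 (norm_nonneg _) h4.le
    nlinarith
  let f : V → ℝ := fun x => posq (w x)
  have hf : LipschitzWith (⟨2 * cw, by positivity⟩ * Lw) f := by
    refine LipschitzWith.of_dist_le_mul fun x y => ?_
    rw [Real.dist_eq]
    refine (posq_diff (hwb x) (hwb y)).trans ?_
    have := hw.dist_le_mul x y
    rw [Real.dist_eq] at this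
    have e : (((⟨2 * cw, by positivity⟩ * Lw : ℝ≥0)) : ℝ) = 2 * cw * Lw := rfl
    rw [e, mul_assoc (2 * cw)]
    exact mul_le_mul_of_nonneg_left this (by positivity)
  have hf0 : ∀ x, 0 ≤ f x := fun x => posq_nonneg _
  have hfb : ∀ x, ‖f x‖ ≤ cw ^ 2 := fun x => by
    rw [Real.norm_of_nonneg (hf0 x)]
    exact pow_le_pow_left₀ (le_max_right _ _) (max_le ((le_abs_self _).trans (hwb x)) hcw) 2
  let g : Fin d → V → ℝ := fun i x => ψδ x * β x (b i)
  have hβi : ∀ i, ContDiff ℝ 1 (fun x => β x (b i)) := fun i => hβC.clm_apply contDiff_const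
  have hgC : ∀ i, ContDiff ℝ 1 (g i) := fun i => hψδC.mul (hβi i)
  have hgs : ∀ i, HasCompactSupport (g i) := fun i => hψδs.mul_right
  have hgd : ∀ i x, fderiv ℝ (g i) x (b i)
      = ψδ x * (fderiv ℝ β x (b i) (b i)) + fderiv ℝ ψδ x (b i) * β x (b i) := by
    intro i x
    have h1 := (hψδC.differentiable (by norm_num) x).hasFDerivAt
    have h2 : HasFDerivAt (fun x => β x (b i))
        ((ContinuousLinearMap.apply ℝ ℝ (b i)).comp (fderiv ℝ β x)) x :=
      (ContinuousLinearMap.apply ℝ ℝ (b i)).hasFDerivAt.comp x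
        (hβC.differentiable (by norm_num) x).hasFDerivAt
    have h3 : HasFDerivAt (g i) _ x := h1.mul h2
    rw [h3.fderiv]
    simp [mul_comm]
  have hibp : ∀ i, ∫ x, lineDeriv ℝ f x (b i) * g i x = - ∫ x, fderiv ℝ (g i) x (b i) * f x := by
    intro i
    obtain ⟨D, hD⟩ := (hgC i).lipschitzWith_of_hasCompactSupport (hgs i) (by norm_num)
    rw [hf.integral_lineDeriv_mul_eq hD (hgs i), ← integral_neg]
    refine integral_congr_ae (Eventually.of_forall fun x => ?_)
    dsimp
    rw [((hgC i).differentiable (by norm_num) x).lineDeriv_eq_fderiv]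
    simp
  have hgI : ∀ i, Integrable (g i) volume := fun i =>
    (hgC i).continuous.integrable_of_hasCompactSupport (hgs i)
  have hI1 : ∀ i, Integrable (fun x => lineDeriv ℝ f x (b i) * g i x) volume := by
    intro i
    refine (hgI i).bdd_mul (c := (⟨2 * cw, by positivity⟩ * Lw : ℝ≥0) * ‖b i‖) ?_ ?_
    · exact (measurable_lineDeriv hf.continuous).aestronglyMeasurable
    · exact Eventually.of_forall fun x => norm_lineDeriv_le_of_lipschitz ℝ hf
  have hI2 : ∀ i, Integrable (fun x => fderiv ℝ (g i) x (b i) * f x) volume := by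
    intro i
    refine Integrable.mul_bdd (c := cw ^ 2) ?_ hf.continuous.aestronglyMeasurable
      (Eventually.of_forall hfb)
    refine Continuous.integrable_of_hasCompactSupport ?_ ?_
    · exact ((hgC i).continuous_fderiv (by norm_num)).clm_apply continuous_const
    · exact (hgs i).fderiv_apply ℝ (b i)
  have hI3 : Integrable (fun x => ψ x ^ 2 * f x) volume :=
    hψ.int.mul_bdd (c := cw ^ 2) hf.continuous.aestronglyMeasurable (Eventually.of_forall hfb)
  have hL : ∫ x, posq (ψ x - δ) * (2 * max (w x) 0 * β x (gradient w x))
      = ∑ i, ∫ x, lineDeriv ℝ f x (b i) * g i x := by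
    rw [← integral_finsetSum _ (fun i _ => hI1 i)]
    refine integral_congr_ae ?_
    filter_upwards [hw.ae_differentiableAt (μ := volume)] with x hx
    have h1 : HasFDerivAt f ((2 * max (w x) 0) • fderiv ℝ w x) x :=
      (posq_hasDerivAt (w x)).comp_hasFDerivAt x hx.hasFDerivAt
    have h2 : ∀ i, lineDeriv ℝ f x (b i) = 2 * max (w x) 0 * ⟪gradient w x, b i⟫ := by
      intro i
      rw [h1.differentiableAt.lineDeriv_eq_fderiv, h1.fderiv, gradient_inner]
      rfl
    have h3 : gradient w x = ∑ i, ⟪gradient w x, b i⟫ • b i := by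
      conv_lhs => rw [← b.sum_repr (gradient w x)]
      refine Finset.sum_congr rfl fun j _ => ?_
      rw [b.repr_apply_apply, real_inner_comm]
    have h4 : β x (gradient w x) = ∑ i, ⟪gradient w x, b i⟫ * β x (b i) := by
      conv_lhs => rw [h3]
      simp [map_sum]
    rw [h4, Finset.mul_sum, Finset.mul_sum]
    refine Finset.sum_congr rfl fun i _ => ?_
    rw [h2]
    simp only [g, ψδ]
    ring
  rw [hL]
  simp only [hibp]
  rw [Finset.sum_neg_distrib, ← integral_finsetSum _ (fun i _ => hI2 i), neg_mul]
  refine neg_le_neg ?_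
  rw [← integral_const_mul]
  refine integral_mono (integrable_finsetSum _ fun i _ => hI2 i) (hI3.const_mul _) ?_
  intro x
  dsimp only
  rw [← Finset.sum_mul, ← mul_assoc]
  refine mul_le_mul_of_nonneg_right ?_ (hf0 x)
  simp only [hgd]
  rw [Finset.sum_add_distrib, ← Finset.mul_sum, add_mul]
  have hd1 := div_beta_le d hH.smooth hH.conv hu hC hs x (hH.bd2 d (norm_gradient_le d huL x))
    (hH.bd3 d (norm_gradient_le d huL x))
  have hK : 0 ≤ K1 := by positivity
  refine add_le_add ?_ ?_
  · calc _ ≤ ψδ x * K1 := mul_le_mul_of_nonneg_left hd1 (hψδ0 x)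
      _ ≤ ψ x ^ 2 * K1 := mul_le_mul_of_nonneg_right (hψδle x) hK
      _ = _ := mul_comm _ _
  · have : ∀ i, fderiv ℝ ψδ x (b i) * β x (b i) ≤ (2 * c * ψ x ^ 2) * B := by
      intro i
      have h1 := (fderiv ℝ ψδ x).le_opNorm (b i)
      have h2 := (β x).le_opNorm (b i)
      rw [b.norm_eq_one, mul_one] at h1 h2
      refine (le_abs_self _).trans ?_
      rw [abs_mul]
      exact mul_le_mul (h1.trans (hψδd x)) (h2.trans (hβn x)) (abs_nonneg _)
        ((norm_nonneg _).trans (hψδd x))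
    calc _ ≤ ∑ i : Fin d, (2 * c * ψ x ^ 2) * B := Finset.sum_le_sum fun i _ => this i
      _ = _ := by simp; ring
lemma measurable_gradient' (u : V → ℝ) : Measurable (gradient u) :=
  (InnerProductSpace.toDual ℝ V).symm.continuous.measurable.comp (measurable_fderiv ℝ u)

lemma det_ineq {ψ : V → ℝ} {c : ℝ} (hψ : Weight d ψ c) {h : V → V → ℝ} {L : ℝ≥0} {B C : ℝ}
    (hB : 0 ≤ B) (hH : HamBd d h L B) (hC : 0 ≤ C)
    {u₁ u₂ : V → ℝ} (hu₁ : LipschitzWith L u₁) (hs : SemiconcaveWith d C u₁)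
    (hu₂ : LipschitzWith L u₂) {cu : ℝ} (hb₁ : ∀ x, |u₁ x| ≤ cu) (hb₂ : ∀ x, |u₂ x| ≤ cu) :
    -(C * (d * B) + d * B + d * (2 * c * B)) * ∫ x, ψ x ^ 2 * posq (u₂ x - u₁ x) ≤
      ∫ x, ψ x ^ 2 * (2 * max (u₂ x - u₁ x) 0 *
        (h (gradient u₂ x) x - h (gradient u₁ x) x)) := by
  set K := C * (d * B) + d * B + d * (2 * c * B)
  obtain ⟨un, hun, hunL, huns, hunlim⟩ := mollify d hu₁ hC hs
  set w : V → ℝ := fun x => u₂ x - u₁ x with hwdef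
  have hw : LipschitzWith (L + L) w := hu₂.sub hu₁
  have hwb : ∀ x, |w x| ≤ 2 * cu := fun x => by
    have := abs_sub (u₂ x) (u₁ x)
    have := hb₁ x; have := hb₂ x
    simp only [hwdef]
    linarith
  have hcu : 0 ≤ cu := (abs_nonneg _).trans (hb₁ 0)
  have hmaxb : ∀ x, |2 * max (w x) 0| ≤ 4 * cu := fun x => by
    rw [abs_of_nonneg (by positivity)]
    have : max (w x) 0 ≤ 2 * cu := max_le ((le_abs_self _).trans (hwb x)) (by positivity)
    linarith
  have hgw : ∀ x, ‖gradient w x‖ ≤ 2 * L := fun x => by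
    have := norm_gradient_le d hw x
    push_cast at this
    linarith
  have hcore : ∀ n : ℕ, -K * ∫ x, ψ x ^ 2 * posq (w x) ≤
      ∫ x, posq (ψ x - 1 / ((n : ℝ) + 1)) *
        (2 * max (w x) 0 * betaF d h (gradient (un n)) x (gradient w x)) := fun n =>
    ibp_core d hψ hB hH (hun n) (hunL n) hC (huns n) hw hwb (by positivity)
  have hDp := contDiff_DpH d hH.smooth
  have hmeas : ∀ p : V → V, Measurable p →
      AEStronglyMeasurable (fun x => betaF d h p x (gradient w x)) volume := by
    intro p hp
    have h1 : Measurable (betaF d h p) := by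
      have : betaF d h p = (fun q : V × V => fderiv ℝ (fun r => h r q.2) q.1) ∘
        (fun x => (p x, x)) := rfl
      rw [this]
      exact hDp.continuous.measurable.comp (hp.prodMk measurable_id)
    have h2 := h1.aestronglyMeasurable (μ := volume) |>.prodMk
      (measurable_gradient' d w).aestronglyMeasurable
    exact (isBoundedBilinearMap_apply (𝕜 := ℝ) (E := V) (F := ℝ)).continuous.comp_aestronglyMeasurable h2
  have hbound : ∀ p : V → V, (∀ x, ‖p x‖ ≤ L) → ∀ x,
      |2 * max (w x) 0 * betaF d h p x (gradient w x)| ≤ 4 * cu * (B * (2 * L)) := by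
    intro p hp x
    rw [abs_mul]
    refine mul_le_mul (hmaxb x) ?_ (abs_nonneg _) (by positivity)
    refine ((betaF d h p x).le_opNorm _).trans ?_
    exact mul_le_mul (hH.bd1 d (hp x)) (hgw x) (norm_nonneg _) hB
  have hmaxm : Continuous (fun x => 2 * max (w x) 0) :=
    continuous_const.mul (hw.continuous.max continuous_const)
  have hlim : Tendsto (fun n : ℕ => ∫ x, posq (ψ x - 1 / ((n : ℝ) + 1)) *
        (2 * max (w x) 0 * betaF d h (gradient (un n)) x (gradient w x))) atTop
      (𝓝 (∫ x, ψ x ^ 2 * (2 * max (w x) 0 * betaF d h (gradient u₁) x (gradient w x)))) := by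
    refine tendsto_integral_of_dominated_convergence
      (fun x => ψ x ^ 2 * (4 * cu * (B * (2 * L)))) ?_ (hψ.int.mul_const _) ?_ ?_
    · intro n
      refine AEStronglyMeasurable.mul ?_ (hmaxm.aestronglyMeasurable.mul
        (hmeas _ (measurable_gradient' d _)))
      exact (posq_contDiff.continuous.comp
        (hψ.smooth.continuous.sub continuous_const)).aestronglyMeasurable
    · intro n
      refine Eventually.of_forall fun x => ?_
      rw [norm_mul, Real.norm_of_nonneg (posq_nonneg _)]
      refine mul_le_mul ?_ (hbound _ (norm_gradient_le d (hunL n)) x) (norm_nonneg _) (by positivity)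
      refine pow_le_pow_left₀ (le_max_right _ _) (max_le ?_ (hψ.pos x).le) 2
      have : (0:ℝ) ≤ 1 / ((n : ℝ) + 1) := by positivity
      linarith
    · filter_upwards [hu₁.ae_differentiableAt (μ := volume)] with x hx
      have h1 : Tendsto (fun n : ℕ => posq (ψ x - 1 / ((n : ℝ) + 1))) atTop (𝓝 (ψ x ^ 2)) := by
        have := (posq_contDiff.continuous.tendsto (ψ x - 0)).comp
          (tendsto_const_nhds.sub (tendsto_one_div_add_atTop_nhds_zero_nat (𝕜 := ℝ)))
        have e : posq (ψ x - 0) = ψ x ^ 2 := by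
          rw [sub_zero, posq, max_eq_left (hψ.pos x).le]
        rw [e] at this
        exact this
      have h2 : Tendsto (fun n => betaF d h (gradient (un n)) x) atTop
          (𝓝 (betaF d h (gradient u₁) x)) := by
        have h3 : Tendsto (fun n => (gradient (un n) x, x)) atTop (𝓝 (gradient u₁ x, x)) :=
          (hunlim x hx).prodMk_nhds tendsto_const_nhds
        exact (hDp.continuous.tendsto _).comp h3
      have h4 : Tendsto (fun n => betaF d h (gradient (un n)) x (gradient w x)) atTop
          (𝓝 (betaF d h (gradient u₁) x (gradient w x))) :=
        ((ContinuousLinearMap.apply ℝ ℝ (gradient w x)).continuous.tendsto _).comp h2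
      exact h1.mul (h4.const_mul _)
  refine (ge_of_tendsto' hlim hcore).trans ?_
  have hmh : ∀ u : V → ℝ, LipschitzWith L u → AEStronglyMeasurable (fun x => h (gradient u x) x) volume := by
    intro u _
    have : Measurable (fun x => (gradient u x, x)) := (measurable_gradient' d u).prodMk measurable_id
    exact (hH.smooth.continuous.measurable.comp this).aestronglyMeasurable
  refine integral_mono_ae ?_ ?_ ?_
  · refine hψ.int.mul_bdd (c := 4 * cu * (B * (2 * L))) (hmaxm.aestronglyMeasurable.mul
        (hmeas _ (measurable_gradient' d _))) (Eventually.of_forall ?_)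
    exact hbound _ (norm_gradient_le d hu₁)
  · refine hψ.int.mul_bdd (c := 4 * cu * (B + B)) (hmaxm.aestronglyMeasurable.mul
        ((hmh _ hu₂).sub (hmh _ hu₁))) (Eventually.of_forall ?_)
    intro x
    rw [norm_mul]
    refine mul_le_mul (hmaxb x) ?_ (abs_nonneg _) (by positivity)
    exact (norm_sub_le _ _).trans (add_le_add (hH.bd0 d (norm_gradient_le d hu₂ x))
      (hH.bd0 d (norm_gradient_le d hu₁ x)))
  · filter_upwards [hu₁.ae_differentiableAt (μ := volume), hu₂.ae_differentiableAt (μ := volume)]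
      with x h1 h2
    refine mul_le_mul_of_nonneg_left ?_ (by positivity)
    refine mul_le_mul_of_nonneg_left ?_ (by positivity)
    have e : gradient w x = gradient u₂ x - gradient u₁ x := by
      have : fderiv ℝ w x = fderiv ℝ u₂ x - fderiv ℝ u₁ x := fderiv_fun_sub h2 h1
      simp only [gradient, this, map_sub]
    rw [e]
    have hd : Differentiable ℝ (fun r => h r x) :=
      (hH.smooth.comp (by fun_prop : ContDiff ℝ 2 fun r : V => (r, x))).differentiable (by norm_num)
    exact convex_grad_ineq (hH.conv x) (hd _).hasFDerivAt _
lemma mem_of_ae_Icc {T : ℝ} (hT : 0 < T) {P : ℝ → Prop}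
    (hP : ∀ᵐ t ∂(volume.restrict (Icc (0:ℝ) T)), P t) {f : ℝ → ℝ} (hf : ContinuousOn f (Icc 0 T))
    {c : ℝ} (hc : ∀ t ∈ Icc 0 T, P t → f t ≤ c) : ∀ t ∈ Icc 0 T, f t ≤ c := by
  rw [ae_restrict_iff' measurableSet_Icc] at hP
  have hd : Dense {t | t ∈ Icc 0 T → P t} := Measure.dense_of_ae hP
  have h1 : Icc 0 T ⊆ closure (Ioo 0 T ∩ {t | t ∈ Icc 0 T → P t}) := by
    have := closure_minimal (hd.open_subset_closure_inter (isOpen_Ioo (a := (0:ℝ)) (b := T)))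
      isClosed_closure
    rwa [closure_Ioo hT.ne] at this
  intro t ht
  have h2 := h1 ht
  have hmaps : MapsTo f (Ioo 0 T ∩ {t | t ∈ Icc 0 T → P t}) (Iic c) := fun s hs =>
    hc s (Ioo_subset_Icc_self hs.1) (hs.2 (Ioo_subset_Icc_self hs.1))
  have h3 : ContinuousWithinAt f (Ioo 0 T ∩ {t | t ∈ Icc 0 T → P t}) t :=
    (hf t ht).mono (inter_subset_left.trans Ioo_subset_Icc_self)
  have := h3.mem_closure h2 hmaps
  simpa using this

structure VReg (μ : Measure Ω) (T : ℝ) (u : ℝ → V → Ω → ℝ) (C : ℝ) (v : ℝ → V → Ω → ℝ) : Prop where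
  cont : ∀ ω, Continuous fun q : ℝ × V => v q.1 q.2 ω
  meas : ∀ t x, Measurable (v t x)
  bd : ∀ t x ω, |v t x ω| ≤ C
  lip : ∀ t ω, LipschitzWith C.toNNReal fun x => v t x ω
  semi : ∀ t ω, SemiconcaveWith d C fun x => v t x ω
  eq : ∀ᵐ ω ∂μ, ∀ t ∈ Icc 0 T, ∀ x, v t x ω = u t x ω

lemma SemiconcaveWith.mono {C C' : ℝ} (h : C ≤ C') {f : V → ℝ} (hf : SemiconcaveWith d C f) :
    SemiconcaveWith d C' f := by
  intro x y θ h0 h1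
  refine (hf x y θ h0 h1).trans ?_
  have : 0 ≤ θ * (1 - θ) := mul_nonneg h0 (by linarith)
  gcongr

lemma VReg.mono {μ : Measure Ω} {T : ℝ} {u : ℝ → V → Ω → ℝ} {C C' : ℝ} {v : ℝ → V → Ω → ℝ}
    (h : VReg d μ T u C v) (hC : C ≤ C') : VReg d μ T u C' v where
  cont := h.cont
  meas := h.meas
  bd t x ω := (h.bd t x ω).trans hC
  lip t ω := (h.lip t ω).weaken (Real.toNNReal_le_toNNReal hC)
  semi t ω := (h.semi t ω).mono d hC
  eq := h.eq

lemma exists_vreg {μ : Measure Ω} {F : Filtration ℝ mΩ} {T : ℝ} (hT : 0 < T)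
    {u M : ℝ → V → Ω → ℝ} (h : HJReg d μ F T u M) : ∃ C v, 0 < C ∧ VReg d μ T u C v := by
  obtain ⟨C, hC, hb⟩ := h.bdd
  have hgood : ∀ᵐ ω ∂μ, (∀ x : V, ContinuousOn (fun t => u t x ω) (Icc 0 T)) ∧
      ∀ t ∈ Icc 0 T, (∀ x : V, |u t x ω| ≤ C) ∧ LipschitzWith C.toNNReal (fun x : V => u t x ω) ∧
      SemiconcaveWith d C fun x : V => u t x ω := by
    filter_upwards [h.cont_u, hb] with ω hc hb
    refine ⟨hc, ?_⟩
    have e1 : ∀ x : V, ∀ t ∈ Icc 0 T, |u t x ω| ≤ C := fun x =>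
      mem_of_ae_Icc hT hb (hc x).abs fun t _ hp => (hp.1 x).1
    have e2 : ∀ x y : V, ∀ t ∈ Icc 0 T, |u t x ω - u t y ω| ≤ C * dist x y := fun x y =>
      mem_of_ae_Icc hT hb ((hc x).sub (hc y)).abs fun t _ hp => by
        have := hp.2.1.dist_le_mul x y
        rwa [Real.dist_eq, Real.coe_toNNReal _ hC.le] at this
    have e3 : ∀ x y : V, ∀ θ : ℝ, 0 ≤ θ → θ ≤ 1 → ∀ t ∈ Icc 0 T,
        θ * u t x ω + (1 - θ) * u t y ω - u t (θ • x + (1 - θ) • y) ω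
          ≤ C / 2 * (θ * (1 - θ)) * ‖x - y‖ ^ 2 := fun x y θ h0 h1 =>
      mem_of_ae_Icc hT hb ((((hc x).const_smul θ).add ((hc y).const_smul (1-θ))).sub (hc _))
        fun t _ hp => hp.2.2 x y θ h0 h1
    refine fun t ht => ⟨fun x => e1 x t ht, ?_, fun x y θ h0 h1 => e3 x y θ h0 h1 t ht⟩
    refine LipschitzWith.of_dist_le_mul fun x y => ?_
    rw [Real.dist_eq, Real.coe_toNNReal _ hC.le]
    exact e2 x y t ht
  obtain ⟨S, hS1, hS2, hS3⟩ := (ae_iff.1 hgood) ▸ exists_measurable_superset μ {ω | ¬ _}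
  have hSg : ∀ ω, ω ∉ S → _ := fun ω hω => by
    have : ω ∉ {ω | ¬ _} := fun hh => hω (hS1 hh)
    exact not_not.1 this
  have hSae : ∀ᵐ ω ∂μ, ω ∉ S := by
    rw [ae_iff]; simpa using hS3
  classical
  let pr : ℝ → ℝ := fun t => (projIcc 0 T hT.le t : ℝ)
  have hpr : Continuous pr := continuous_subtype_val.comp continuous_projIcc
  have hprm : ∀ t, pr t ∈ Icc 0 T := fun t => (projIcc 0 T hT.le t).2
  refine ⟨C, fun t x ω => if ω ∈ S then 0 else u (pr t) x ω, hC, ?_, ?_, ?_, ?_, ?_, ?_⟩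
  · intro ω
    by_cases hω : ω ∈ S
    · simpa [hω] using continuous_const
    · simp only [hω, if_false]
      obtain ⟨g1, g2⟩ := hSg ω hω
      refine continuous_prod_of_continuous_lipschitzWith' (fun q : ℝ × V => u (pr q.1) q.2 ω) C.toNNReal
        ?_ ?_
      · exact fun t => (g2 (pr t) (hprm t)).2.1
      · exact fun x => (g1 x).comp_continuous hpr hprm
  · intro t x
    refine Measurable.ite hS2 measurable_const ?_
    exact (h.adapted_u x (pr t)).mono (F.le _) le_rfl
  · intro t x ω
    by_cases hω : ω ∈ S
    · simpa [hω] using hC.le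
    · simp only [hω, if_false]
      exact ((hSg ω hω).2 (pr t) (hprm t)).1 x
  · intro t ω
    by_cases hω : ω ∈ S
    · simpa [hω] using LipschitzWith.const' (0:ℝ)
    · simp only [hω, if_false]
      exact ((hSg ω hω).2 (pr t) (hprm t)).2.1
  · intro t ω
    by_cases hω : ω ∈ S
    · simp only [hω, if_true]
      intro x y θ h0 h1
      have : 0 ≤ θ * (1 - θ) := mul_nonneg h0 (by linarith)
      simp only [mul_zero, add_zero, sub_zero]
      positivity
    · simp only [hω, if_false]
      exact ((hSg ω hω).2 (pr t) (hprm t)).2.2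
  · filter_upwards [hSae] with ω hω t ht x
    simp only [hω, if_false]
    have : pr t = t := by simp [pr, projIcc_of_mem hT.le ht]
    rw [this]

lemma grad_char {f : V → ℝ} (hf : Continuous f) (p x : V) :
    HasGradientAt f p x ↔ ∀ m : ℕ, ∃ N : ℕ, ∀ k : ℕ, ‖TopologicalSpace.denseSeq V k‖ < 1 / ((N:ℝ) + 1) →
      |f (x + TopologicalSpace.denseSeq V k) - f x - ⟪p, TopologicalSpace.denseSeq V k⟫|
        ≤ 1 / ((m:ℝ) + 1) * ‖TopologicalSpace.denseSeq V k‖ := by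
  rw [hasGradientAt_iff_isLittleO_nhds_zero, Asymptotics.isLittleO_iff]
  constructor
  · intro h m
    have hm : (0:ℝ) < 1 / ((m:ℝ) + 1) := by positivity
    obtain ⟨ε, hε, hb⟩ := Metric.eventually_nhds_iff.1 (h hm)
    obtain ⟨N, hN⟩ := exists_nat_one_div_lt hε
    refine ⟨N, fun k hk => ?_⟩
    have := hb (y := TopologicalSpace.denseSeq V k) (by rw [dist_zero_right]; exact hk.trans hN)
    simpa [Real.norm_eq_abs] using this
  · intro h c hc
    obtain ⟨m, hm⟩ := exists_nat_one_div_lt hc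
    obtain ⟨N, hN⟩ := h m
    rw [Metric.eventually_nhds_iff]
    refine ⟨1 / ((N:ℝ) + 1), by positivity, fun y hy => ?_⟩
    rw [dist_zero_right] at hy
    have hcl : y ∈ closure (Metric.ball (0:V) (1 / ((N:ℝ) + 1)) ∩ range (TopologicalSpace.denseSeq V)) :=
      (TopologicalSpace.denseRange_denseSeq V).open_subset_closure_inter Metric.isOpen_ball
        (by simpa using hy)
    have hclosed : IsClosed {y : V | |f (x + y) - f x - ⟪p, y⟫| ≤ 1 / ((m:ℝ) + 1) * ‖y‖} :=
      isClosed_le (by fun_prop) (by fun_prop)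
    have : y ∈ {y : V | |f (x + y) - f x - ⟪p, y⟫| ≤ 1 / ((m:ℝ) + 1) * ‖y‖} := by
      refine closure_minimal ?_ hclosed hcl
      rintro z ⟨hz, k, rfl⟩
      exact hN k (by simpa using hz)
    rw [Real.norm_eq_abs]
    refine le_trans this ?_
    gcongr

lemma measurable_gradient_param {α : Type*} [MeasurableSpace α] {f : α → V → ℝ}
    (hf : ∀ a, Continuous (f a)) (hm : Measurable fun q : α × V => f q.1 q.2) :
    Measurable fun q : α × V => gradient (f q.1) q.2 := by
  classical
  let e : Fin d → V := fun i => EuclideanSpace.single i 1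
  let r : ℕ → ℝ := fun n => 1 / ((n:ℝ) + 1)
  let pc : Fin d → α × V → ℝ := fun i q =>
    limsup (fun n : ℕ => (r n)⁻¹ * (f q.1 (q.2 + r n • e i) - f q.1 q.2)) atTop
  have hsh : ∀ z : V, Measurable fun q : α × V => f q.1 (q.2 + z) := fun z =>
    hm.comp (measurable_fst.prodMk (measurable_snd.add_const z))
  have hpc : ∀ i, Measurable (pc i) := fun i =>
    Measurable.limsup fun n => ((hsh _).sub hm).const_mul _
  let p : α × V → V := fun q => WithLp.toLp 2 fun i => pc i q
  have hp : Measurable p := by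
    refine (WithLp.measurable_toLp 2 _).comp ?_
    exact measurable_pi_lambda _ hpc
  let D : Set (α × V) := {q | ∀ m : ℕ, ∃ N : ℕ, ∀ k : ℕ,
    ‖TopologicalSpace.denseSeq V k‖ < 1 / ((N:ℝ) + 1) →
      |f q.1 (q.2 + TopologicalSpace.denseSeq V k) - f q.1 q.2 - ⟪p q, TopologicalSpace.denseSeq V k⟫|
        ≤ 1 / ((m:ℝ) + 1) * ‖TopologicalSpace.denseSeq V k‖}
  have hD : MeasurableSet D := by
    have : D = ⋂ m : ℕ, ⋃ N : ℕ, ⋂ k : ℕ, {q | ‖TopologicalSpace.denseSeq V k‖ < 1 / ((N:ℝ) + 1) →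
      |f q.1 (q.2 + TopologicalSpace.denseSeq V k) - f q.1 q.2 - ⟪p q, TopologicalSpace.denseSeq V k⟫|
        ≤ 1 / ((m:ℝ) + 1) * ‖TopologicalSpace.denseSeq V k‖} := by
      ext q; simp [D]
    rw [this]
    refine MeasurableSet.iInter fun m => MeasurableSet.iUnion fun N => MeasurableSet.iInter fun k => ?_
    by_cases hk : ‖TopologicalSpace.denseSeq V k‖ < 1 / ((N:ℝ) + 1)
    · simp only [hk, true_imp_iff]
      refine measurableSet_le ?_ measurable_const
      have h1 : Measurable fun q => ⟪p q, TopologicalSpace.denseSeq V k⟫ :=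
        hp.inner measurable_const
      exact (((hsh _).sub hm).sub h1).abs
    · simp only [hk, false_imp_iff, ofPred_true, MeasurableSet.univ]
  have key : (fun q : α × V => gradient (f q.1) q.2) = D.piecewise p (fun _ => 0) := by
    ext1 q
    by_cases hq : q ∈ D
    · rw [piecewise_eq_of_mem _ _ _ hq]
      exact ((grad_char d (hf q.1) (p q) q.2).2 hq).gradient
    · rw [piecewise_eq_of_notMem _ _ _ hq]
      by_contra hne
      have hdiff : DifferentiableAt ℝ (f q.1) q.2 := by
        by_contra hnd
        exact hne (gradient_eq_zero_of_not_differentiableAt hnd)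
      have hg := hdiff.hasGradientAt
      have hpe : p q = gradient (f q.1) q.2 := by
        ext i
        have hlim : Tendsto (fun n : ℕ => (r n)⁻¹ * (f q.1 (q.2 + r n • e i) - f q.1 q.2)) atTop
            (𝓝 (fderiv ℝ (f q.1) q.2 (e i))) := by
          have h1 := (hdiff.hasFDerivAt.hasLineDerivAt (e i)).tendsto_slope_zero
          have h2 : Tendsto r atTop (𝓝[≠] 0) := by
            refine tendsto_nhdsWithin_iff.2 ⟨tendsto_one_div_add_atTop_nhds_zero_nat, ?_⟩
            exact Eventually.of_forall fun n => by
              simp only [r, mem_compl_iff, mem_singleton_iff]; positivity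
          have h3 := h1.comp h2
          simp only [smul_eq_mul] at h3
          exact h3
        have : pc i q = fderiv ℝ (f q.1) q.2 (e i) := hlim.limsup_eq
        change pc i q = _
        rw [this, ← gradient_inner]
        simp only [e]
        rw [EuclideanSpace.inner_single_right]
        simp only [one_mul, conj_trivial]
      rw [← hpe] at hg
      exact hq ((grad_char d (hf q.1) (p q) q.2).1 hg)
  rw [key]
  exact Measurable.piecewise hD hp measurable_const

lemma gronwall_abs {X : Type*} [MeasurableSpace X] (P : Measure X) [IsFiniteMeasure P]
    {T A K : ℝ} (hA : 0 ≤ A) {w D : ℝ → X → ℝ}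
    (hwm : Measurable fun q : ℝ × X => w q.1 q.2) (hDm : Measurable fun q : ℝ × X => D q.1 q.2)
    (hwc : ∀ z, Continuous fun t => w t z) (hwb : ∀ t z, |w t z| ≤ A) (hDb : ∀ t z, |D t z| ≤ A)
    (hdet : ∀ s, -K * ∫ z, posq (w s z) ∂P ≤ ∫ z, 2 * max (w s z) 0 * D s z ∂P)
    (hstep : ∀ t t', 0 ≤ t → t < t' → t' ≤ T →
      0 ≤ ∫ z, max (w t z) 0 * (w t' z - w t z - ∫ s in Ioc t t', D s z) ∂P)
    (hT : ∀ᵐ z ∂P, w T z ≤ 0) : ∀ t ∈ Icc 0 T, ∀ᵐ z ∂P, w t z ≤ 0 := by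
  have hw1 : ∀ t, Measurable (w t) := fun t => hwm.comp (measurable_const.prodMk measurable_id)
  have hD1 : ∀ t, Measurable (D t) := fun t => hDm.comp (measurable_const.prodMk measurable_id)
  have bint : ∀ {f : X → ℝ} (c : ℝ), Measurable f → (∀ z, |f z| ≤ c) → Integrable f P :=
    fun c hf hb => Integrable.of_bound hf.aestronglyMeasurable c (Eventually.of_forall fun z => by
      simpa [Real.norm_eq_abs] using hb z)
  have hmax : ∀ t z, |max (w t z) 0| ≤ A := fun t z => by
    have := hwb t z
    rw [abs_le] at this ⊢
    constructor
    · linarith [le_max_right (w t z) 0]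
    · exact max_le this.2 hA
  have hmaxm : ∀ t, Measurable fun z => max (w t z) 0 := fun t => (hw1 t).max measurable_const
  let Φ : ℝ → ℝ := fun t => ∫ z, posq (w t z) ∂P
  let m : ℝ × ℝ → ℝ := fun q => ∫ z, |w q.1 z - w q.2 z| ∂P
  have hpm : ∀ t, Measurable fun z => posq (w t z) := fun t =>
    posq_contDiff.continuous.measurable.comp (hw1 t)
  have hpb : ∀ t z, |posq (w t z)| ≤ A ^ 2 := fun t z => by
    rw [abs_of_nonneg (posq_nonneg _)]
    have := hmax t z
    unfold posq
    rw [← sq_abs]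
    gcongr
  have hΦ : Continuous Φ := by
    refine continuous_of_dominated (bound := fun _ => A ^ 2)
      (fun t => (hpm t).aestronglyMeasurable) (fun t => Eventually.of_forall fun z => hpb t z)
      (integrable_const _) (Eventually.of_forall fun z => posq_contDiff.continuous.comp (hwc z))
  have hmb : ∀ q : ℝ × ℝ, ∀ z, |w q.1 z - w q.2 z| ≤ 2 * A := fun q z => by
    have := abs_sub (w q.1 z) (w q.2 z)
    linarith [hwb q.1 z, hwb q.2 z]
  have hm : Continuous m := by
    refine continuous_of_dominated (bound := fun _ => 2 * A)
      (fun q => ((hw1 q.1).sub (hw1 q.2)).abs.aestronglyMeasurable)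
      (fun q => Eventually.of_forall fun z => by simpa using hmb q z)
      (integrable_const _) (Eventually.of_forall fun z => ?_)
    exact (((hwc z).comp continuous_fst).sub ((hwc z).comp continuous_snd)).abs
  have hDint : ∀ t t' : ℝ, Integrable (fun q : ℝ × X => max (w t q.2) 0 * D q.1 q.2)
      ((volume.restrict (Ioc t t')).prod P) := fun t t' => by
    refine Integrable.of_bound (((hmaxm t).comp measurable_snd).mul hDm).aestronglyMeasurable
      (A * A) (Eventually.of_forall fun q => ?_)
    rw [Real.norm_eq_abs, abs_mul]
    exact mul_le_mul (hmax _ _) (hDb _ _) (abs_nonneg _) hA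
  have hmain : ∀ t t', 0 ≤ t → t < t' → t' ≤ T →
      Φ t - Φ t' ≤ ∫ s in Ioc t t', (K * Φ s + 2 * A * m (t, s)) := by
    intro t t' h0 htt hT'
    have i1 : Integrable (fun z => max (w t z) 0 * (w t' z - w t z)) P := by
      refine bint (A * (2 * A)) ((hmaxm t).mul ((hw1 t').sub (hw1 t))) fun z => ?_
      rw [abs_mul]
      exact mul_le_mul (hmax _ _) (hmb (t', t) z) (abs_nonneg _) hA
    have i2 : Integrable (fun z => max (w t z) 0 * ∫ s in Ioc t t', D s z) P := by
      have := (hDint t t').swap.integral_prod_left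
      simpa [integral_const_mul] using this
    have e1 : Φ t + 2 * ∫ z, max (w t z) 0 * (w t' z - w t z) ∂P ≤ Φ t' := by
      rw [← integral_const_mul, ← integral_add (bint _ (hpm t) (hpb t)) (i1.const_mul 2)]
      refine integral_mono ((bint _ (hpm t) (hpb t)).add (i1.const_mul 2))
        (bint _ (hpm t') (hpb t')) fun z => ?_
      have := posq_convex (w t z) (w t' z)
      simp only []
      linarith
    have e2 := hstep t t' h0 htt hT'
    have e3 : ∫ z, max (w t z) 0 * (w t' z - w t z - ∫ s in Ioc t t', D s z) ∂P
        = ∫ z, max (w t z) 0 * (w t' z - w t z) ∂P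
          - ∫ z, max (w t z) 0 * (∫ s in Ioc t t', D s z) ∂P := by
      rw [← integral_sub i1 i2]
      congr 1; ext z; ring
    have e4 : ∫ z, max (w t z) 0 * (∫ s in Ioc t t', D s z) ∂P
        = ∫ s in Ioc t t', ∫ z, max (w t z) 0 * D s z ∂P := by
      rw [integral_integral_swap (f := fun s z => max (w t z) 0 * D s z) (hDint t t')]
      simp only [integral_const_mul]
    have i3 : ∀ t s, Integrable (fun z => max (w t z) 0 * D s z) P := fun t s => by
      refine bint (A * A) ((hmaxm t).mul (hD1 s)) fun z => ?_
      rw [abs_mul]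
      exact mul_le_mul (hmax _ _) (hDb _ _) (abs_nonneg _) hA
    have e5 : ∀ s, -(K * Φ s + 2 * A * m (t, s)) ≤ 2 * ∫ z, max (w t z) 0 * D s z ∂P := by
      intro s
      have h1 := hdet s
      have h2 : ∫ z, 2 * max (w s z) 0 * D s z ∂P = 2 * ∫ z, max (w s z) 0 * D s z ∂P := by
        rw [← integral_const_mul]; congr 1; ext z; ring
      have i4 : Integrable (fun z => |w t z - w s z|) P :=
        bint (2 * A) ((hw1 t).sub (hw1 s)).abs fun z => by simpa using hmb (t, s) z
      have h3 : ∫ z, max (w s z) 0 * D s z ∂P - A * m (t, s) ≤ ∫ z, max (w t z) 0 * D s z ∂P := by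
        simp only [m]
        rw [← integral_const_mul, ← integral_sub (i3 s s) (i4.const_mul A)]
        refine integral_mono ((i3 s s).sub (i4.const_mul A)) (i3 t s) fun z => ?_
        simp only []
        have a1 : |max (w s z) 0 - max (w t z) 0| ≤ |w s z - w t z| :=
          abs_max_sub_max_le_abs _ _ _
        have a2 : (max (w s z) 0 - max (w t z) 0) * D s z ≤ |w t z - w s z| * A := by
          refine (le_abs_self _).trans ?_
          rw [abs_mul, abs_sub_comm (w t z)]
          exact mul_le_mul a1 (hDb _ _) (abs_nonneg _) (abs_nonneg _)
        linarith
      have h4 : (∫ z, posq (w s z) ∂P) = Φ s := rfl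
      rw [h2, h4] at h1
      linarith
    have e6 : -∫ s in Ioc t t', (K * Φ s + 2 * A * m (t, s))
        ≤ 2 * ∫ s in Ioc t t', ∫ z, max (w t z) 0 * D s z ∂P := by
      rw [← integral_const_mul, ← integral_neg]
      refine integral_mono ?_ ?_ fun s => e5 s
      · refine (Continuous.integrableOn_Ioc ?_).neg
        have : Continuous fun s => m (t, s) := hm.comp (continuous_const.prodMk continuous_id)
        fun_prop
      · exact ((hDint t t').integral_prod_left).const_mul 2
    rw [e3, e4] at e2
    linarith
  have hgr : ∀ τ ∈ Icc 0 T, Φ (T - τ) ≤ gronwallBound 0 K 0 (τ - 0) := by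
    refine le_gronwallBound_of_liminf_deriv_right_le (f' := fun τ => K * Φ (T - τ))
      (hΦ.comp (continuous_const.sub continuous_id)).continuousOn ?_ ?_ ?_
    · intro τ hτ r hr
      refine Eventually.frequently ?_
      obtain ⟨r', hr1, hr2⟩ := exists_between hr
      have hg : Continuous fun q : ℝ × ℝ => K * Φ q.2 + 2 * A * m q := by fun_prop
      have hm0 : m (T - τ, T - τ) = 0 := by simp [m]
      have hev : ∀ᶠ q in 𝓝 (T - τ, T - τ), K * Φ q.2 + 2 * A * m q < r' := by
        refine hg.continuousAt.eventually_lt continuousAt_const ?_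
        simp only [hm0]
        linarith
      rw [Metric.eventually_nhds_iff] at hev
      obtain ⟨ε, hε, hev⟩ := hev
      have hz : ∀ᶠ z in 𝓝[>] τ, z ∈ Ioo τ (min (τ + ε) T) :=
        Ioo_mem_nhdsGT (lt_min (by linarith) hτ.2)
      filter_upwards [hz] with z hz
      have hz1 := hz.1
      have hz2 := lt_min_iff.1 hz.2
      have h1 := hmain (T - z) (T - τ) (by linarith) (by linarith) (by linarith [hτ.1])
      have h2 : ∫ s in Ioc (T - z) (T - τ), (K * Φ s + 2 * A * m (T - z, s))
          ≤ ∫ s in Ioc (T - z) (T - τ), r' := by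
        refine setIntegral_mono_on ?_ ?_ measurableSet_Ioc fun s hs => ?_
        · refine Continuous.integrableOn_Ioc ?_
          have : Continuous fun s => m (T - z, s) := hm.comp (continuous_const.prodMk continuous_id)
          fun_prop
        · exact integrableOn_const (by simp)
        · refine (hev (y := (T - z, s)) ?_).le
          rw [Prod.dist_eq, max_lt_iff, Real.dist_eq, Real.dist_eq, abs_lt, abs_lt]
          have := hs.1
          have := hs.2
          refine ⟨⟨?_, ?_⟩, ?_, ?_⟩ <;> simp only [] <;> linarith
      rw [setIntegral_const, measureReal_def, Real.volume_Ioc,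
        ENNReal.toReal_ofReal (by linarith), smul_eq_mul] at h2
      have hzτ : 0 < z - τ := by linarith
      rw [inv_mul_lt_iff₀ hzτ]
      have : (z - τ) * r' < (z - τ) * r := by gcongr
      nlinarith
    · have : Φ (T - 0) = 0 := by
        simp only [Φ, sub_zero]
        refine integral_eq_zero_of_ae ?_
        filter_upwards [hT] with z hz
        exact posq_eq_zero.2 hz
      exact this.le
    · intro τ _
      simp
  intro t ht
  have h1 := hgr (T - t) ⟨by linarith [ht.2], by linarith [ht.1]⟩
  rw [gronwallBound_ε0, zero_mul] at h1
  have h2 : T - (T - t) = t := by ring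
  rw [h2] at h1
  have h3 : Φ t = 0 := le_antisymm h1 (integral_nonneg fun z => posq_nonneg _)
  have h4 := (integral_eq_zero_iff_of_nonneg (fun z => posq_nonneg _)
    (bint _ (hpm t) (hpb t))).1 h3
  filter_upwards [h4] with z hz
  exact posq_eq_zero.1 hz

lemma core {ψ : V → ℝ} {c : ℝ} (hψ : Weight d ψ c) (μ : Measure Ω) [IsProbabilityMeasure μ]
    {T A K : ℝ} (hT : 0 < T) (hA : 0 ≤ A) {w D : ℝ → V → Ω → ℝ}
    (hwc : ∀ ω, Continuous fun q : ℝ × V => w q.1 q.2 ω) (hwm : ∀ t x, Measurable (w t x))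
    (hwb : ∀ t x ω, |w t x ω| ≤ A)
    (hDm : Measurable fun q : ℝ × (V × Ω) => D q.1 q.2.1 q.2.2) (hDb : ∀ t x ω, |D t x ω| ≤ A)
    (hdet : ∀ s ω, -K * ∫ x, ψ x ^ 2 * posq (w s x ω) ≤
      ∫ x, ψ x ^ 2 * (2 * max (w s x ω) 0 * D s x ω))
    (hstep : ∀ᵐ x ∂(volume : Measure V), ∀ t t', 0 ≤ t → t < t' → t' ≤ T →
      0 ≤ ∫ ω, max (w t x ω) 0 * (w t' x ω - w t x ω - ∫ s in Ioc t t', D s x ω) ∂μ)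
    (hterm : ∀ᵐ x ∂(volume : Measure V), ∀ᵐ ω ∂μ, w T x ω ≤ 0) :
    ∀ᵐ ω ∂μ, ∀ x, ∀ t ∈ Icc 0 T, w t x ω ≤ 0 := by
  have hψm : Measurable fun x => ENNReal.ofReal (ψ x ^ 2) :=
    (hψ.smooth.continuous.pow 2).measurable.ennreal_ofReal
  set ν : Measure V := volume.withDensity fun x => ENNReal.ofReal (ψ x ^ 2) with hν
  have : IsFiniteMeasure ν := isFiniteMeasure_withDensity_ofReal hψ.int.2
  have hν1 : ν ≪ volume := withDensity_absolutelyContinuous _ _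
  have hν2 : volume ≪ ν := by
    refine withDensity_absolutelyContinuous' hψm.aemeasurable (Eventually.of_forall fun x => ?_)
    have := hψ.pos x
    simp only [ne_eq, ENNReal.ofReal_eq_zero, not_le]
    positivity
  have hνi : ∀ f : V → ℝ, ∫ x, f x ∂ν = ∫ x, ψ x ^ 2 * f x := fun f => by
    rw [hν, integral_withDensity_eq_integral_toReal_smul hψm (by simp)]
    refine integral_congr_ae (Eventually.of_forall fun x => ?_)
    simp only [smul_eq_mul]
    rw [ENNReal.toReal_ofReal (sq_nonneg _)]
  have hwj : Measurable fun q : ℝ × (V × Ω) => w q.1 q.2.1 q.2.2 := by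
    have h1 : Measurable (Function.uncurry fun (q : ℝ × V) (ω : Ω) => w q.1 q.2 ω) := by
      refine measurable_uncurry_of_continuous_of_measurable (fun ω => hwc ω) fun q => hwm q.1 q.2
    exact h1.comp ((measurable_fst.prodMk (measurable_fst.comp measurable_snd)).prodMk
      (measurable_snd.comp measurable_snd))
  have hw1 : ∀ t, Measurable fun z : V × Ω => w t z.1 z.2 := fun t =>
    hwj.comp (measurable_const.prodMk measurable_id)
  have hD1 : ∀ t, Measurable fun z : V × Ω => D t z.1 z.2 := fun t =>
    hDm.comp (measurable_const.prodMk measurable_id)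
  have hmax : ∀ t x ω, |max (w t x ω) 0| ≤ A := fun t x ω => by
    have := hwb t x ω
    rw [abs_le] at this ⊢
    constructor
    · linarith [le_max_right (w t x ω) 0]
    · exact max_le this.2 hA
  have hmaxm : ∀ t, Measurable fun z : V × Ω => max (w t z.1 z.2) 0 :=
    fun t => (hw1 t).max measurable_const
  have bint : ∀ {f : V × Ω → ℝ} (c : ℝ), Measurable f → (∀ z, |f z| ≤ c) → Integrable f (ν.prod μ) :=
    fun c hf hb => Integrable.of_bound hf.aestronglyMeasurable c (Eventually.of_forall fun z => by
      simpa [Real.norm_eq_abs] using hb z)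
  have hpi : ∀ t, Integrable (fun z : V × Ω => posq (w t z.1 z.2)) (ν.prod μ) := fun t => by
    refine bint (A ^ 2) (posq_contDiff.continuous.measurable.comp (hw1 t)) fun z => ?_
    rw [abs_of_nonneg (posq_nonneg _)]
    have := hmax t z.1 z.2
    unfold posq
    rw [← sq_abs]
    gcongr
  have hres := gronwall_abs (X := V × Ω) (ν.prod μ) (T := T) (A := A) (K := K) hA
    (w := fun t z => w t z.1 z.2) (D := fun t z => D t z.1 z.2) hwj hDm
    (fun z => (hwc z.2).comp (continuous_id.prodMk continuous_const))
    (fun t z => hwb _ _ _) (fun t z => hDb _ _ _) ?_ ?_ ?_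
  rotate_left
  · intro s
    have i2 : Integrable (fun z : V × Ω => 2 * max (w s z.1 z.2) 0 * D s z.1 z.2) (ν.prod μ) := by
      refine bint (2 * A * A) (((hmaxm s).const_mul 2).mul (hD1 s)) fun z => ?_
      rw [abs_mul, abs_mul, abs_two]
      have := hmax s z.1 z.2
      have := hDb s z.1 z.2
      gcongr
    rw [integral_prod_symm _ (hpi s), integral_prod_symm _ i2, ← integral_const_mul]
    refine integral_mono ((hpi s).integral_prod_right.const_mul _) i2.integral_prod_right fun ω => ?_
    simp only [hνi]
    exact hdet s ω
  · intro t t' h0 htt hT'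
    have hDi : Measurable fun z : V × Ω => ∫ s in Ioc t t', D s z.1 z.2 := by
      have : StronglyMeasurable fun z : V × Ω => ∫ s in Ioc t t', D s z.1 z.2 :=
        StronglyMeasurable.integral_prod_left (μ := volume.restrict (Ioc t t'))
          (f := fun (s : ℝ) (z : V × Ω) => D s z.1 z.2) hDm.stronglyMeasurable
      exact this.measurable
    have hDib : ∀ z : V × Ω, |∫ s in Ioc t t', D s z.1 z.2| ≤ A * (t' - t) := fun z => by
      have := norm_setIntegral_le_of_norm_le_const (μ := volume) (s := Ioc t t') (C := A)
        (f := fun s => D s z.1 z.2) (by simp) (fun s _ => hDb _ _ _)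
      rwa [measureReal_def, Real.volume_Ioc, ENNReal.toReal_ofReal (by linarith)] at this
    have i : Integrable (fun z : V × Ω => max (w t z.1 z.2) 0 *
        (w t' z.1 z.2 - w t z.1 z.2 - ∫ s in Ioc t t', D s z.1 z.2)) (ν.prod μ) := by
      refine bint (A * (A + A + A * (t' - t))) ((hmaxm t).mul (((hw1 t').sub (hw1 t)).sub hDi))
        fun z => ?_
      rw [abs_mul]
      refine mul_le_mul (hmax _ _ _) ?_ (abs_nonneg _) hA
      refine (abs_sub _ _).trans (add_le_add ((abs_sub _ _).trans ?_) (hDib z))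
      exact add_le_add (hwb _ _ _) (hwb _ _ _)
    rw [integral_prod _ i]
    refine integral_nonneg_of_ae ?_
    filter_upwards [hν1.ae_le hstep] with x hx
    exact hx t t' h0 htt hT'
  · rw [Measure.ae_prod_iff_ae_ae]
    · exact hν1.ae_le hterm
    · exact measurableSet_le (hw1 T) measurable_const
  have h2 : ∀ t ∈ Icc 0 T, ∀ᵐ ω ∂μ, ∀ x, w t x ω ≤ 0 := by
    intro t ht
    have h3 : ∀ᵐ x ∂ν, ∀ᵐ ω ∂μ, w t x ω ≤ 0 := Measure.ae_ae_of_ae_prod (hres t ht)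
    rw [Measure.ae_ae_comm (p := fun x ω => w t x ω ≤ 0)
      (measurableSet_le (hw1 t) measurable_const)] at h3
    filter_upwards [h3] with ω hω x
    have h4 : Dense {x | w t x ω ≤ 0} := Measure.dense_of_ae (hν2.ae_le hω)
    have h5 : IsClosed {x | w t x ω ≤ 0} :=
      isClosed_le ((hwc ω).comp (continuous_const.prodMk continuous_id)) continuous_const
    have h6 := h4.closure_eq
    rw [h5.closure_eq] at h6
    have : x ∈ {x | w t x ω ≤ 0} := by rw [h6]; trivial
    exact this
  have h3 : ∀ᵐ ω ∂μ, ∀ q : ℚ, (q : ℝ) ∈ Icc 0 T → ∀ x, w q x ω ≤ 0 := by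
    rw [ae_all_iff]
    intro q
    by_cases hq : (q : ℝ) ∈ Icc 0 T
    · filter_upwards [h2 q hq] with ω hω _
      exact hω
    · exact Eventually.of_forall fun ω h => absurd h hq
  filter_upwards [h3] with ω hω x t ht
  have h5 : IsClosed {t | w t x ω ≤ 0} :=
      isClosed_le ((hwc ω).comp (continuous_id.prodMk continuous_const)) continuous_const
  have h6 := closure_minimal ((Rat.denseRange_cast (𝕜 := ℝ)).open_subset_closure_inter
    (isOpen_Ioo (a := (0:ℝ)) (b := T))) isClosed_closure
  rw [closure_Ioo hT.ne] at h6
  refine closure_minimal ?_ h5 (h6 ht)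
  rintro _ ⟨hs, q, rfl⟩
  exact hω q (Ioo_subset_Icc_self hs) x

lemma mart_zero (μ : Measure Ω) [IsProbabilityMeasure μ] {F : Filtration ℝ mΩ} {N : ℝ → Ω → ℝ}
    (hN : Martingale N F μ) {t t' : ℝ} (h : t ≤ t') {ξ : Ω → ℝ} (hξ : Measurable[F t] ξ) {A : ℝ}
    (hb : ∀ᵐ ω ∂μ, |ξ ω| ≤ A) :
    Integrable (fun ω => ξ ω * (N t' ω - N t ω)) μ ∧ ∫ ω, ξ ω * (N t' ω - N t ω) ∂μ = 0 := by
  have hsm : StronglyMeasurable[F t] ξ := hξ.stronglyMeasurable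
  have hb' : ∀ᵐ ω ∂μ, ‖ξ ω‖ ≤ A := hb
  have i : ∀ s, Integrable (ξ * N s) μ := fun s =>
    (hN.integrable s).bdd_mul (hsm.mono (F.le t)).aestronglyMeasurable hb'
  have e1 : ∫ ω, (ξ * N t') ω ∂μ = ∫ ω, (ξ * N t) ω ∂μ := by
    rw [← integral_condExp (F.le t) (f := ξ * N t')]
    refine integral_congr_ae ?_
    filter_upwards [condExp_stronglyMeasurable_mul_of_bound (F.le t) hsm (hN.integrable t') A hb',
      hN.condExp_ae_eq h] with ω h1 h2
    rw [h1, Pi.mul_apply, h2, Pi.mul_apply]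
  have e : (fun ω => ξ ω * (N t' ω - N t ω)) = fun ω => (ξ * N t') ω - (ξ * N t) ω := by
    ext ω; simp only [Pi.mul_apply]; ring
  rw [e]
  exact ⟨(i t').sub (i t), by rw [integral_sub (i t') (i t), e1, sub_self]⟩

lemma step_abs (μ : Measure Ω) [IsProbabilityMeasure μ] {F : Filtration ℝ mΩ} {T A : ℝ} (hT : 0 < T)
    (hA : 0 ≤ A) {w wt D N : ℝ → Ω → ℝ} (hN : Martingale N F μ)
    (hwt : ∀ t, Measurable[F t] (wt t)) (hwe : ∀ t ∈ Icc 0 T, ∀ᵐ ω ∂μ, w t ω = wt t ω)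
    (hwc : ∀ ω, Continuous fun t => w t ω) (hw1 : ∀ t, Measurable (w t)) (hwb : ∀ t ω, |w t ω| ≤ A)
    (hDm : Measurable fun q : ℝ × Ω => D q.1 q.2) (hDb : ∀ t ω, |D t ω| ≤ A)
    (hineq : ∀ᵐ q ∂((volume.restrict (Icc (0:ℝ) T)).prod (volume.restrict (Icc (0:ℝ) T))),
      q.1 < q.2 → ∀ᵐ ω ∂μ, w q.1 ω ≤ w q.2 ω - (∫ s in Ioc q.1 q.2, D s ω) - N q.2 ω + N q.1 ω) :
    ∀ t t', 0 ≤ t → t < t' → t' ≤ T →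
      0 ≤ ∫ ω, max (w t ω) 0 * (w t' ω - w t ω - ∫ s in Ioc t t', D s ω) ∂μ := by
  have hmax : ∀ t ω, |max (w t ω) 0| ≤ A := fun t z => by
    have := hwb t z
    rw [abs_le] at this ⊢
    constructor
    · linarith [le_max_right (w t z) 0]
    · exact max_le this.2 hA
  have hmaxm : ∀ t, Measurable fun z => max (w t z) 0 := fun t => (hw1 t).max measurable_const
  have hDs : ∀ ω, Measurable fun s => D s ω := fun ω =>
    hDm.comp (measurable_id.prodMk measurable_const)
  have hDi : ∀ ω a b, IntervalIntegrable (fun s => D s ω) volume a b := fun ω a b => by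
    have h : ∀ a b : ℝ, IntegrableOn (fun s => D s ω) (Ioc a b) := fun a b =>
      Integrable.of_bound (hDs ω).aestronglyMeasurable A (Eventually.of_forall fun s => hDb s ω)
    exact ⟨h _ _, h _ _⟩
  let I : ℝ × ℝ → Ω → ℝ := fun q ω => ∫ s in q.1..q.2, D s ω
  have hIeq : ∀ t t' ω, t ≤ t' → I (t, t') ω = ∫ s in Ioc t t', D s ω := fun t t' ω h => by
    simp only [I]; rw [intervalIntegral.integral_of_le h]
  have hIoc : ∀ t t' : ℝ, Measurable fun ω => ∫ s in Ioc t t', D s ω := fun t t' => by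
    have : StronglyMeasurable fun ω => ∫ s in Ioc t t', D s ω :=
        StronglyMeasurable.integral_prod_left (μ := volume.restrict (Ioc t t'))
          (f := fun (s : ℝ) ω => D s ω) hDm.stronglyMeasurable
    exact this.measurable
  have hIm : ∀ q, Measurable (I q) := fun q => by
    simp only [I, intervalIntegral]
    exact (hIoc _ _).sub (hIoc _ _)
  have hIc : ∀ ω, Continuous fun q => I q ω := fun ω => by
    have h0 := intervalIntegral.continuous_primitive (hDi ω) 0
    have : (fun q => I q ω) = fun q : ℝ × ℝ => (∫ s in (0:ℝ)..q.2, D s ω) - ∫ s in (0:ℝ)..q.1, D s ω := by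
      ext q
      exact (intervalIntegral.integral_interval_sub_left (hDi ω _ _) (hDi ω _ _)).symm
    rw [this]
    exact (h0.comp continuous_snd).sub (h0.comp continuous_fst)
  let f : ℝ × ℝ → Ω → ℝ := fun q ω => max (w q.1 ω) 0 * (w q.2 ω - w q.1 ω - I q ω)
  have hfm : ∀ q, Measurable (f q) := fun q =>
    (hmaxm q.1).mul (((hw1 q.2).sub (hw1 q.1)).sub (hIm q))
  have hfb : ∀ q ∈ Icc (0:ℝ) T ×ˢ Icc (0:ℝ) T, ∀ ω, ‖f q ω‖ ≤ A * (A + A + A * T) := by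
    intro q hq ω
    rw [Real.norm_eq_abs, abs_mul]
    have hIb : |I q ω| ≤ A * T := by
      have h1 := intervalIntegral.norm_integral_le_of_norm_le_const (a := q.1) (b := q.2) (C := A)
        (f := fun s => D s ω) (fun s _ => hDb s ω)
      refine h1.trans ?_
      gcongr
      rw [abs_le]
      constructor <;> linarith [hq.1.1, hq.1.2, hq.2.1, hq.2.2]
    refine mul_le_mul (hmax _ _) ?_ (abs_nonneg _) hA
    refine (abs_sub _ _).trans (add_le_add ((abs_sub _ _).trans ?_) hIb)
    exact add_le_add (hwb _ _) (hwb _ _)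
  have hfi : ∀ q ∈ Icc (0:ℝ) T ×ˢ Icc (0:ℝ) T, Integrable (f q) μ := fun q hq =>
    Integrable.of_bound (hfm q).aestronglyMeasurable _ (Eventually.of_forall (hfb q hq))
  have hfc : ContinuousOn (fun q => ∫ ω, f q ω ∂μ) (Icc (0:ℝ) T ×ˢ Icc (0:ℝ) T) := by
    refine continuousOn_of_dominated (bound := fun _ => A * (A + A + A * T))
      (fun q _ => (hfm q).aestronglyMeasurable) (fun q hq => Eventually.of_forall (hfb q hq))
      (integrable_const _) (Eventually.of_forall fun ω => Continuous.continuousOn ?_)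
    have h1 : Continuous fun q : ℝ × ℝ => w q.1 ω := (hwc ω).comp continuous_fst
    have h2 : Continuous fun q : ℝ × ℝ => w q.2 ω := (hwc ω).comp continuous_snd
    exact (h1.max continuous_const).mul ((h2.sub h1).sub (hIc ω))
  have hgen : ∀ᵐ q ∂((volume : Measure ℝ).prod (volume : Measure ℝ)),
      q ∈ Icc (0:ℝ) T ×ˢ Icc (0:ℝ) T → q.1 < q.2 → 0 ≤ ∫ ω, f q ω ∂μ := by
    rw [Measure.prod_restrict, ae_restrict_iff' (measurableSet_Icc.prod measurableSet_Icc)] at hineq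
    filter_upwards [hineq] with q hq hqm hlt
    have h1 := hq hqm hlt
    obtain ⟨j1, j2⟩ := mart_zero μ hN hlt.le (ξ := fun ω => max (wt q.1 ω) 0) (A := A)
      ((hwt q.1).max measurable_const) (by
        filter_upwards [hwe q.1 hqm.1] with ω h
        rw [← h]; exact hmax _ _)
    rw [← j2]
    refine integral_mono_ae j1 (hfi q hqm) ?_
    filter_upwards [h1, hwe q.1 hqm.1] with ω h1 h2
    simp only [f]
    rw [← h2, hIeq _ _ _ hlt.le]
    refine mul_le_mul_of_nonneg_left ?_ (le_max_right _ _)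
    linarith
  intro t t' h0 htt hT'
  let O : Set (ℝ × ℝ) := {q | q.1 < q.2} ∩ (Ioo 0 T ×ˢ Ioo 0 T)
  have hlt : IsOpen {q : ℝ × ℝ | q.1 < q.2} := isOpen_lt continuous_fst continuous_snd
  have hO : IsOpen O := hlt.inter (isOpen_Ioo.prod isOpen_Ioo)
  have hmem : (t, t') ∈ closure O := by
    refine hlt.inter_closure ⟨htt, ?_⟩
    rw [closure_prod_eq, closure_Ioo hT.ne]
    exact ⟨⟨h0, by linarith⟩, ⟨by linarith, hT'⟩⟩
  have hd : Dense {q : ℝ × ℝ | q ∈ Icc (0:ℝ) T ×ˢ Icc (0:ℝ) T → q.1 < q.2 → 0 ≤ ∫ ω, f q ω ∂μ} :=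
    Measure.dense_of_ae hgen
  have hmem2 := closure_minimal (hd.open_subset_closure_inter hO) isClosed_closure hmem
  have hsub : O ⊆ Icc (0:ℝ) T ×ˢ Icc (0:ℝ) T := fun q hq =>
    ⟨Ioo_subset_Icc_self hq.2.1, Ioo_subset_Icc_self hq.2.2⟩
  have hcw : ContinuousWithinAt (fun q => ∫ ω, f q ω ∂μ) (O ∩ {q : ℝ × ℝ | q ∈ Icc (0:ℝ) T ×ˢ Icc (0:ℝ) T → q.1 < q.2 → 0 ≤ ∫ ω, f q ω ∂μ}) (t, t') :=
    (hfc (t, t') ⟨⟨h0, by linarith⟩, ⟨by linarith, hT'⟩⟩).mono (inter_subset_left.trans hsub)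
  have hfin := hcw.mem_closure (t := Ici 0) hmem2 fun q hq => hq.2 (hsub hq.1) hq.1.1
  rw [closure_Ici] at hfin
  have hfin' : 0 ≤ ∫ ω, f (t, t') ω ∂μ := hfin
  refine hfin'.trans_eq (integral_congr_ae (Eventually.of_forall fun ω => ?_))
  simp only [f]
  rw [hIeq _ _ _ htt.le]

/-- Proposition 2.4 / `prop.comparison`, comparison principle:
under (H1), (H2) and (H3), if `(ũ¹, M̃¹)` is a supersolution and `(ũ², M̃²)` a subsolution
of the backward stochastic HJ equation, then `ℙ`-a.s. `ũ¹ ≥ ũ²` on `ℝ^d × [0,T]`. -/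
theorem comparison_backward_stochastic_HJ
    (T : ℝ) (hT : 0 < T)
    (μ : Measure Ω) [IsProbabilityMeasure μ] (F : Filtration ℝ mΩ)
    (W : ℝ → Ω → V) (hW : IsWienerProcess d μ F W)
    (H : ℝ → V → V → Ω → ℝ) (G : V → Ω → ℝ)
    (h1 : H1Hyp d μ F T H G) (h2 : H2Hyp d T H) (h3 : H3Hyp d μ T H)
    (u₁ M₁ u₂ M₂ : ℝ → V → Ω → ℝ)
    (hsuper : IsHJSupersol d μ F T H G u₁ M₁)
    (hsub : IsHJSubsol d μ F T H G u₂ M₂) :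
    ∀ᵐ ω ∂μ, ∀ x : V, ∀ t ∈ Icc (0:ℝ) T, u₂ t x ω ≤ u₁ t x ω := by
  obtain ⟨hreg₁, hsup, hsupT⟩ := hsuper
  obtain ⟨hreg₂, hsb, hsbT⟩ := hsub
  obtain ⟨C₁, v₁, hC₁, hv₁⟩ := exists_vreg d hT hreg₁
  obtain ⟨C₂, v₂, hC₂, hv₂⟩ := exists_vreg d hT hreg₂
  obtain ⟨C, hC1, hC2⟩ : ∃ C, C₁ ≤ C ∧ C₂ ≤ C := ⟨max C₁ C₂, le_max_left _ _, le_max_right _ _⟩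
  have hC : 0 < C := hC₁.trans_le hC1
  replace hv₁ := hv₁.mono d hC1
  replace hv₂ := hv₂.mono d hC2
  obtain ⟨-, -, hsm, had, hct⟩ := h1
  obtain ⟨hconv, hbd, -⟩ := h2
  obtain ⟨B, hB, hbd⟩ := hbd C hC
  obtain ⟨ψ, c, q1, q2, q3, q4, q5, q6, q7⟩ := exists_weight d
  have hψ : Weight d ψ c := ⟨q1, q2, q3, q4, q5, q6, q7⟩
  let pr : ℝ → ℝ := fun t => (projIcc 0 T hT.le t : ℝ)
  have hpr : Continuous pr := continuous_subtype_val.comp continuous_projIcc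
  have hprm : ∀ t, pr t ∈ Icc 0 T := fun t => (projIcc 0 T hT.le t).2
  have hpre : ∀ t ∈ Icc 0 T, pr t = t := fun t ht => by simp [pr, projIcc_of_mem hT.le ht]
  have hCc : ((C.toNNReal : ℝ≥0) : ℝ) = C := Real.coe_toNNReal _ hC.le
  have hHam : ∀ s ω, HamBd d (fun p x => H (pr s) p x ω) (C.toNNReal : ℝ≥0) B := fun s ω =>
    ⟨hsm ω (pr s), hconv _ (hprm s) ω, fun p x hp => hbd _ (hprm s) ω p x (by rwa [hCc] at hp)⟩
  -- joint measurability
  have hHm : Measurable fun q : (V × V) × (ℝ × Ω) => H (pr q.2.1) q.1.1 q.1.2 q.2.2 := by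
    refine measurable_uncurry_of_continuous_of_measurable
      (u := fun (r : V × V) (a : ℝ × Ω) => H (pr a.1) r.1 r.2 a.2)
      (fun a => (hsm a.2 (pr a.1)).continuous) fun r => ?_
    refine measurable_uncurry_of_continuous_of_measurable
      (u := fun (s : ℝ) (ω : Ω) => H (pr s) r.1 r.2 ω)
      (fun ω => (hct r.1 r.2 ω).comp hpr) fun s => ?_
    exact (had r.1 r.2 (pr s)).mono (F.le _) le_rfl
  have hgm : ∀ {u v : ℝ → V → Ω → ℝ}, VReg d μ T u C v →
      Measurable fun q : ℝ × (V × Ω) => H (pr q.1) (gradient (fun y => v q.1 y q.2.2) q.2.1) q.2.1 q.2.2 := by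
    intro u v hv
    have hj : Measurable (Function.uncurry fun (q : ℝ × V) (ω : Ω) => v q.1 q.2 ω) :=
      measurable_uncurry_of_continuous_of_measurable (fun ω => hv.cont ω) fun q => hv.meas q.1 q.2
    have hg := measurable_gradient_param d (α := ℝ × Ω) (f := fun a x => v a.1 x a.2)
      (fun a => (hv.lip a.1 a.2).continuous)
      (hj.comp (f := fun z : (ℝ × Ω) × V => ((z.1.1, z.2), z.1.2)) (by fun_prop))
    have hg' : Measurable fun q : ℝ × (V × Ω) => gradient (fun y => v q.1 y q.2.2) q.2.1 :=
      hg.comp (f := fun q : ℝ × (V × Ω) => ((q.1, q.2.2), q.2.1)) (by fun_prop)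
    have ha : Measurable fun q : ℝ × (V × Ω) => q.2.1 := by fun_prop
    have hb : Measurable fun q : ℝ × (V × Ω) => (q.1, q.2.2) := by fun_prop
    exact hHm.comp ((hg'.prodMk ha).prodMk hb)
  have hgb : ∀ {u v : ℝ → V → Ω → ℝ}, VReg d μ T u C v → ∀ s x ω,
      |H (pr s) (gradient (fun y => v s y ω) x) x ω| ≤ B := by
    intro u v hv s x ω
    exact (hHam s ω).bd0 d (norm_gradient_le d (hv.lip s ω) x)
  have hgs : ∀ {u v : ℝ → V → Ω → ℝ}, VReg d μ T u C v → ∀ x ω (t t' : ℝ),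
      IntegrableOn (fun s => H (pr s) (gradient (fun y => v s y ω) x) x ω) (Ioc t t') := by
    intro u v hv x ω t t'
    refine Integrable.of_bound ?_ B (Eventually.of_forall fun s => hgb hv s x ω)
    exact ((hgm hv).comp (f := fun s : ℝ => (s, (x, ω))) (by fun_prop)).aestronglyMeasurable
  let w : ℝ → V → Ω → ℝ := fun t x ω => v₂ t x ω - v₁ t x ω
  let D : ℝ → V → Ω → ℝ := fun s x ω => H (pr s) (gradient (fun y => v₂ s y ω) x) x ω
    - H (pr s) (gradient (fun y => v₁ s y ω) x) x ω
  let A : ℝ := 2 * C + 2 * B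
  have hA : 0 ≤ A := by positivity
  have hwb : ∀ t x ω, |w t x ω| ≤ A := fun t x ω => by
    have := abs_sub (v₂ t x ω) (v₁ t x ω)
    simp only [w, A]
    linarith [hv₁.bd t x ω, hv₂.bd t x ω]
  have hDb : ∀ t x ω, |D t x ω| ≤ A := fun s x ω => by
    have := abs_sub (H (pr s) (gradient (fun y => v₂ s y ω) x) x ω)
      (H (pr s) (gradient (fun y => v₁ s y ω) x) x ω)
    simp only [D, A]
    linarith [hgb hv₁ s x ω, hgb hv₂ s x ω]
  have hwc : ∀ ω, Continuous fun q : ℝ × V => w q.1 q.2 ω := fun ω => (hv₂.cont ω).sub (hv₁.cont ω)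
  have hwm : ∀ t x, Measurable (w t x) := fun t x => (hv₂.meas t x).sub (hv₁.meas t x)
  have hDm : Measurable fun q : ℝ × (V × Ω) => D q.1 q.2.1 q.2.2 := (hgm hv₂).sub (hgm hv₁)
  have hfinal : ∀ᵐ ω ∂μ, ∀ x, ∀ t ∈ Icc 0 T, w t x ω ≤ 0 := by
    refine core d hψ μ (K := C * (d * B) + d * B + d * (2 * c * B)) hT hA hwc hwm hwb hDm hDb ?_ ?_ ?_
    · intro s ω
      exact det_ineq d hψ hB.le (hHam s ω) hC.le (hv₁.lip s ω) (hv₁.semi s ω) (hv₂.lip s ω)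
        (fun x => hv₁.bd s x ω) (fun x => hv₂.bd s x ω)
    · filter_upwards [hreg₁.mart, hreg₂.mart, Measure.ae_ae_of_ae_prod hsup,
        Measure.ae_ae_of_ae_prod hsb] with x m1 m2 g1 g2
      refine step_abs μ (F := F) (N := (fun t ω => M₂ t x ω) - fun t ω => M₁ t x ω)
        (w := fun t ω => w t x ω) (wt := fun t ω => u₂ t x ω - u₁ t x ω) (D := fun s ω => D s x ω)
        hT hA (m2.1.sub m1.1) (fun t => (hreg₂.adapted_u x t).sub (hreg₁.adapted_u x t)) ?_
        (fun ω => (hwc ω).comp (continuous_id.prodMk continuous_const)) (fun t => hwm t x)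
        (fun t ω => hwb t x ω) (hDm.comp (f := fun q : ℝ × Ω => (q.1, (x, q.2))) (by fun_prop))
        (fun t ω => hDb t x ω) ?_
      · intro t ht
        filter_upwards [hv₁.eq, hv₂.eq] with ω e1 e2
        simp only [w]
        rw [e1 t ht, e2 t ht]
      · have hmem : ∀ᵐ q ∂((volume.restrict (Icc (0:ℝ) T)).prod (volume.restrict (Icc (0:ℝ) T))),
            q ∈ Icc (0:ℝ) T ×ˢ Icc (0:ℝ) T := by
          rw [Measure.prod_restrict]
          exact ae_restrict_mem (measurableSet_Icc.prod measurableSet_Icc)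
        filter_upwards [g1, g2, hmem] with q g1 g2 hq hlt
        filter_upwards [g1 hlt, g2 hlt, hv₁.eq, hv₂.eq] with ω g1 g2 e1 e2
        have conv : ∀ {u v : ℝ → V → Ω → ℝ}, (∀ t ∈ Icc 0 T, ∀ x, v t x ω = u t x ω) →
            ∫ s in Ioc q.1 q.2, H s (gradient (fun y : V => u s y ω) x) x ω =
            ∫ s in Ioc q.1 q.2, H (pr s) (gradient (fun y : V => v s y ω) x) x ω := by
          intro u v e
          refine setIntegral_congr_fun measurableSet_Ioc fun s hs => ?_
          have hs' : s ∈ Icc 0 T := ⟨hq.1.1.trans hs.1.le, hs.2.trans hq.2.2⟩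
          have : (fun y : V => v s y ω) = fun y => u s y ω := funext fun y => e s hs' y
          simp only [this, hpre s hs']
        have hDint : ∫ s in Ioc q.1 q.2, D s x ω =
            (∫ s in Ioc q.1 q.2, H (pr s) (gradient (fun y : V => v₂ s y ω) x) x ω) -
            ∫ s in Ioc q.1 q.2, H (pr s) (gradient (fun y : V => v₁ s y ω) x) x ω :=
          integral_sub (hgs hv₂ x ω _ _) (hgs hv₁ x ω _ _)
        rw [conv e1] at g1
        rw [conv e2] at g2
        rw [hDint]
        simp only [w, Pi.sub_apply]
        rw [e1 _ hq.1, e2 _ hq.1, e1 _ hq.2, e2 _ hq.2]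
        linarith
    · filter_upwards [hsupT, hsbT] with x a1 a2
      filter_upwards [a1, a2, hv₁.eq, hv₂.eq] with ω a1 a2 e1 e2
      have hTT : T ∈ Icc 0 T := ⟨hT.le, le_rfl⟩
      simp only [w]
      rw [e1 T hTT, e2 T hTT]
      linarith
  filter_upwards [hfinal, hv₁.eq, hv₂.eq] with ω hω e1 e2 x t ht
  have := hω x t ht
  simp only [w] at this
  rw [e1 t ht, e2 t ht] at this
  linarith
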